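/- arXiv:1704.08474 — 5 statements merged into one kernel-verified Lean document; each statement's English description precedes it below -/
import Mathlib

section
/- Let n ≥ 2 be an even integer and p ≥ 2 an even integer. The orbits under the natural action of Aut(AT(n,p)) on the vertex set of AT(n,p) are exactly the sets O^0_i = V^0_i ∪ V^1_{p−i} for i ∈ {0,…,(p−2)/2}, the sets O^1_i = V^1_i ∪ V^0_{p−i} for i ∈ {0,…,(p−2)/2}, and the set O_{p/2} = V^0_{p/2} ∪ V^1_{p/2}. -/
open SimpleGraph

/-- Base relation for the armchair nanotube `AT(n,p)`: vertices are pairs `(i, j)` with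
layer `i ∈ {0, …, p}` and position `j ∈ ℤ/2nℤ`.  `(i,j)` is related to `(i, j+1)`,
and to `(i+1, j-1)` when `j ≡ 2 (mod 4)`, and to `(i+1, j+1)` when `j ≡ 3 (mod 4)`. -/
def ATRel (n p : ℕ) (u v : Fin (p + 1) × ZMod (2 * n)) : Prop :=
  (u.1 = v.1 ∧ v.2 = u.2 + 1) ∨
    ((u.1 : ℕ) + 1 = (v.1 : ℕ) ∧
      ((u.2.val % 4 = 2 ∧ v.2 = u.2 - 1) ∨ (u.2.val % 4 = 3 ∧ v.2 = u.2 + 1)))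

/-- The armchair nanotube `AT(n,p)` as a simple graph. -/
def AT (n p : ℕ) : SimpleGraph (Fin (p + 1) × ZMod (2 * n)) :=
  SimpleGraph.fromRel (ATRel n p)

/-- `Vset n p k i` is the set `V^k_i` of vertices of type `k` in layer `i` of `AT(n,p)`:
type `0` means `j mod 4 ∈ {0,1}`, type `1` means `j mod 4 ∈ {2,3}`. -/
def Vset (n p : ℕ) (k i : ℕ) : Set (Fin (p + 1) × ZMod (2 * n)) :=
  {v | (v.1 : ℕ) = i ∧ v.2.val % 4 / 2 = k}

/-- The set of vertices of `AT(n,p)` in layer `i` (the vertex set of the induced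
cycle `C1` for `i = 0`, and of `C2` for `i = p`). -/
def layer (n p : ℕ) (i : ℕ) : Set (Fin (p + 1) × ZMod (2 * n)) :=
  {v | (v.1 : ℕ) = i}

theorem aux_val_add {n : ℕ} (hn : 2 ≤ n) (hne : Even n) (x y : ZMod (2 * n)) :
    (x + y).val % 4 = (x.val + y.val) % 4 := by
  have : NeZero (2 * n) := ⟨by omega⟩
  rw [ZMod.val_add]
  obtain ⟨m, rfl⟩ := hne
  exact Nat.mod_mod_of_dvd _ ⟨m, by ring⟩

theorem aux_val_one {n : ℕ} (hn : 2 ≤ n) : (1 : ZMod (2 * n)).val = 1 := by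
  have h := ZMod.val_natCast_of_lt (n := 2 * n) (a := 1) (by omega)
  simpa using h

theorem aux_val_three {n : ℕ} (hn : 2 ≤ n) : (3 : ZMod (2 * n)).val = 3 := by
  have h := ZMod.val_natCast_of_lt (n := 2 * n) (a := 3) (by omega)
  simpa using h

theorem aux_val_two {n : ℕ} (hn : 2 ≤ n) : (2 : ZMod (2 * n)).val = 2 := by
  have h := ZMod.val_natCast_of_lt (n := 2 * n) (a := 2) (by omega)
  simpa using h

theorem aux_val_sub {n : ℕ} (hn : 2 ≤ n) (hne : Even n) (x y : ZMod (2 * n)) :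
    ((x - y).val + y.val) % 4 = x.val % 4 := by
  rw [← aux_val_add hn hne, sub_add_cancel]

theorem aux_add_one {n : ℕ} (hn : 2 ≤ n) (hne : Even n) (x : ZMod (2 * n)) :
    (x + 1).val % 4 = (x.val + 1) % 4 := by
  rw [aux_val_add hn hne, aux_val_one hn]

theorem aux_sub_one {n : ℕ} (hn : 2 ≤ n) (hne : Even n) (x : ZMod (2 * n)) :
    (x - 1).val % 4 = (x.val + 3) % 4 := by
  have h := aux_val_sub hn hne x 1
  rw [aux_val_one hn] at h
  omega

theorem aux_adj {n p : ℕ} (hn : 2 ≤ n) (hne : Even n) (u v : Fin (p + 1) × ZMod (2 * n)) :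
    (AT n p).Adj u v ↔ ATRel n p u v ∨ ATRel n p v u := by
  unfold AT
  rw [SimpleGraph.fromRel_adj]
  constructor
  · exact fun h => h.2
  · intro h
    refine ⟨?_, h⟩
    rintro rfl
    have h1 := aux_add_one hn hne u.2
    rcases h with (⟨_, h⟩ | ⟨h, _⟩) | (⟨_, h⟩ | ⟨h, _⟩)
    · rw [← h] at h1; omega
    · omega
    · rw [← h] at h1; omega
    · omega

/-- level of a vertex: distance to the bottom boundary -/
def lev {n p : ℕ} (v : Fin (p + 1) × ZMod (2 * n)) : ℕ := 2 * (v.1 : ℕ) + v.2.val % 4 / 2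

def mlev {n p : ℕ} (v : Fin (p + 1) × ZMod (2 * n)) : ℕ := min (lev v) (2 * p + 1 - lev v)

theorem lev_le {n p : ℕ} (v : Fin (p + 1) × ZMod (2 * n)) : lev v ≤ 2 * p + 1 := by
  have := v.1.2
  unfold lev
  omega

theorem rel_lev {n p : ℕ} (hn : 2 ≤ n) (hne : Even n) (u v : Fin (p + 1) × ZMod (2 * n))
    (h : ATRel n p u v) : lev u ≤ lev v + 1 ∧ lev v ≤ lev u + 1 := by
  obtain ⟨i, x⟩ := u
  obtain ⟨j, y⟩ := v
  have h1 := aux_add_one hn hne x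
  have h2 := aux_sub_one hn hne x
  unfold lev
  rcases h with ⟨h, h'⟩ | ⟨h, ⟨h', h''⟩ | ⟨h', h''⟩⟩ <;> dsimp only at * <;> subst_vars <;> omega

theorem adj_lev {n p : ℕ} (hn : 2 ≤ n) (hne : Even n) (u v : Fin (p + 1) × ZMod (2 * n))
    (h : (AT n p).Adj u v) : mlev u ≤ mlev v + 1 := by
  rw [aux_adj hn hne] at h
  unfold mlev
  rcases h with h | h <;> have := rel_lev hn hne _ _ h <;> omega

theorem adj_add {n p : ℕ} (hn : 2 ≤ n) (hne : Even n) (i : Fin (p + 1)) (x : ZMod (2 * n)) :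
    (AT n p).Adj (i, x) (i, x + 1) :=
  (aux_adj hn hne _ _).2 (Or.inl (Or.inl ⟨rfl, rfl⟩))

theorem adj_sub {n p : ℕ} (hn : 2 ≤ n) (hne : Even n) (i : Fin (p + 1)) (x : ZMod (2 * n)) :
    (AT n p).Adj (i, x) (i, x - 1) :=
  (aux_adj hn hne _ _).2 (Or.inr (Or.inl ⟨rfl, by simp⟩))

theorem exists_same {n p : ℕ} (hn : 2 ≤ n) (hne : Even n) (u : Fin (p + 1) × ZMod (2 * n)) :
    ∃ w, (AT n p).Adj u w ∧ lev w = lev u := by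
  obtain ⟨i, x⟩ := u
  have h1 := aux_add_one hn hne x
  have h2 := aux_sub_one hn hne x
  rcases Nat.mod_two_eq_zero_or_one x.val with h | h
  · exact ⟨_, adj_add hn hne i x, by unfold lev; dsimp only; omega⟩
  · exact ⟨_, adj_sub hn hne i x, by unfold lev; dsimp only; omega⟩

theorem exists_up {n p : ℕ} (hn : 2 ≤ n) (hne : Even n) (u : Fin (p + 1) × ZMod (2 * n))
    (hu : lev u < 2 * p + 1) :
    ∃ w, (AT n p).Adj u w ∧ lev w = lev u + 1 := by
  obtain ⟨i, x⟩ := u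
  have h1 := aux_add_one hn hne x
  have h2 := aux_sub_one hn hne x
  have h4 : x.val % 4 = 0 ∨ x.val % 4 = 1 ∨ x.val % 4 = 2 ∨ x.val % 4 = 3 := by omega
  unfold lev at hu
  dsimp only at hu
  rcases h4 with h | h | h | h
  · exact ⟨_, adj_sub hn hne i x, by unfold lev; dsimp only; omega⟩
  · exact ⟨_, adj_add hn hne i x, by unfold lev; dsimp only; omega⟩
  · refine ⟨(⟨i + 1, by omega⟩, x - 1), (aux_adj hn hne _ _).2 (Or.inl (Or.inr
      ⟨rfl, Or.inl ⟨h, rfl⟩⟩)), by unfold lev; dsimp only; omega⟩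
  · refine ⟨(⟨i + 1, by omega⟩, x + 1), (aux_adj hn hne _ _).2 (Or.inl (Or.inr
      ⟨rfl, Or.inr ⟨h, rfl⟩⟩)), by unfold lev; dsimp only; omega⟩

theorem exists_down {n p : ℕ} (hn : 2 ≤ n) (hne : Even n) (u : Fin (p + 1) × ZMod (2 * n))
    (hu : 0 < lev u) :
    ∃ w, (AT n p).Adj u w ∧ lev w + 1 = lev u := by
  obtain ⟨i, x⟩ := u
  have h1 := aux_add_one hn hne x
  have h2 := aux_sub_one hn hne x
  have h4 : x.val % 4 = 0 ∨ x.val % 4 = 1 ∨ x.val % 4 = 2 ∨ x.val % 4 = 3 := by omega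
  unfold lev at hu
  dsimp only at hu
  have hi := i.2
  rcases h4 with h | h | h | h
  · refine ⟨(⟨i - 1, by omega⟩, x - 1), (aux_adj hn hne _ _).2 (Or.inr (Or.inr
      ⟨by dsimp only; omega, Or.inr ⟨by dsimp only; omega, by simp⟩⟩)),
      by unfold lev; dsimp only; omega⟩
  · refine ⟨(⟨i - 1, by omega⟩, x + 1), (aux_adj hn hne _ _).2 (Or.inr (Or.inr
      ⟨by dsimp only; omega, Or.inl ⟨by dsimp only; omega, by simp⟩⟩)),
      by unfold lev; dsimp only; omega⟩
  · exact ⟨_, adj_sub hn hne i x, by unfold lev; dsimp only; omega⟩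
  · exact ⟨_, adj_add hn hne i x, by unfold lev; dsimp only; omega⟩

theorem boundary_nbrs {n p : ℕ} (hn : 2 ≤ n) (hne : Even n) (u : Fin (p + 1) × ZMod (2 * n))
    (hu : mlev u = 0) (w : Fin (p + 1) × ZMod (2 * n)) (h : (AT n p).Adj u w) :
    w = (u.1, u.2 + 1) ∨ w = (u.1, u.2 - 1) := by
  obtain ⟨i, x⟩ := u
  obtain ⟨j, y⟩ := w
  have h1 := aux_add_one hn hne y
  have h2 := aux_sub_one hn hne y
  have hi := i.2
  have hj := j.2
  rw [aux_adj hn hne] at h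
  unfold mlev lev at hu
  dsimp only at hu
  rcases h with (⟨h, h'⟩ | ⟨h, ⟨h', h''⟩ | ⟨h', h''⟩⟩) | (⟨h, h'⟩ | ⟨h, ⟨h', h''⟩ | ⟨h', h''⟩⟩)
    <;> dsimp only at *
  · left; rw [h, h']
  · omega
  · omega
  · right; rw [h, h']; simp
  · rw [← h''] at h2; omega
  · rw [← h''] at h1; omega

theorem mlev_aut_le {n p : ℕ} (hn : 2 ≤ n) (hne : Even n) (α : (AT n p) ≃g (AT n p)) :
    ∀ k, ∀ u, mlev u = k → mlev (α u) ≤ k := by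
  intro k
  induction k with
  | zero =>
    intro u hu
    by_contra hc
    have hle := lev_le (α u)
    have hc' : 0 < lev (α u) ∧ lev (α u) < 2 * p + 1 := by
      unfold mlev at hc; omega
    obtain ⟨a, ha, hla⟩ := exists_same hn hne (α u)
    obtain ⟨b, hb, hlb⟩ := exists_up hn hne (α u) hc'.2
    obtain ⟨c, hcc, hlc⟩ := exists_down hn hne (α u) hc'.1
    have key : ∀ w, (AT n p).Adj (α u) w →
        w = α (u.1, u.2 + 1) ∨ w = α (u.1, u.2 - 1) := by
      intro w hw
      have : (AT n p).Adj u (α.symm w) := by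
        rw [← α.map_adj_iff]; simpa using hw
      rcases boundary_nbrs hn hne u hu _ this with h | h
      · left; rw [← h]; simp
      · right; rw [← h]; simp
    have hab : a ≠ b := by rintro rfl; omega
    have hac : a ≠ c := by rintro rfl; omega
    have hbc : b ≠ c := by rintro rfl; omega
    rcases key a ha with h1 | h1 <;> rcases key b hb with h2 | h2 <;>
      rcases key c hcc with h3 | h3 <;> simp_all
  | succ k ih =>
    intro u hu
    have hle := lev_le u
    have : ∃ w, (AT n p).Adj u w ∧ mlev w = k := by
      unfold mlev at hu
      by_cases h : lev u ≤ p
      · obtain ⟨w, hw, hl⟩ := exists_down hn hne u (by omega)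
        exact ⟨w, hw, by unfold mlev; omega⟩
      · obtain ⟨w, hw, hl⟩ := exists_up hn hne u (by omega)
        exact ⟨w, hw, by unfold mlev; omega⟩
    obtain ⟨w, hw, hk⟩ := this
    have h1 := ih w hk
    have h2 := adj_lev hn hne _ _ (α.map_adj_iff.2 hw)
    omega

theorem mlev_aut {n p : ℕ} (hn : 2 ≤ n) (hne : Even n) (α : (AT n p) ≃g (AT n p))
    (u : Fin (p + 1) × ZMod (2 * n)) : mlev (α u) = mlev u := by
  apply le_antisymm
  · exact mlev_aut_le hn hne α _ u rfl
  · simpa using mlev_aut_le hn hne α.symm _ (α u) rfl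

theorem adj_shift {n p : ℕ} (hn : 2 ≤ n) (hne : Even n) (t : ZMod (2 * n)) (ht : t.val % 4 = 0)
    (u v : Fin (p + 1) × ZMod (2 * n)) (h : (AT n p).Adj u v) :
    (AT n p).Adj (u.1, u.2 + t) (v.1, v.2 + t) := by
  have key : ∀ u v : Fin (p + 1) × ZMod (2 * n), ATRel n p u v →
      ATRel n p (u.1, u.2 + t) (v.1, v.2 + t) := by
    intro u v h
    have h1 := aux_val_add hn hne u.2 t
    rcases h with ⟨h, h'⟩ | ⟨h, ⟨h', h''⟩ | ⟨h', h''⟩⟩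
    · exact Or.inl ⟨h, by dsimp only; rw [h']; ring⟩
    · exact Or.inr ⟨h, Or.inl ⟨by dsimp only; omega, by dsimp only; rw [h'']; ring⟩⟩
    · exact Or.inr ⟨h, Or.inr ⟨by dsimp only; omega, by dsimp only; rw [h'']; ring⟩⟩
  rw [aux_adj hn hne] at h ⊢
  exact h.imp (key _ _) (key _ _)

theorem adj_refl {n p : ℕ} (hn : 2 ≤ n) (hne : Even n) (t : ZMod (2 * n)) (ht : t.val % 4 = 1)
    (u v : Fin (p + 1) × ZMod (2 * n)) (h : (AT n p).Adj u v) :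
    (AT n p).Adj (u.1, t - u.2) (v.1, t - v.2) := by
  have key : ∀ u v : Fin (p + 1) × ZMod (2 * n), ATRel n p u v →
      ATRel n p (u.1, t - u.2) (v.1, t - v.2) ∨ ATRel n p (v.1, t - v.2) (u.1, t - u.2) := by
    intro u v h
    have h1 := aux_val_sub hn hne t u.2
    rcases h with ⟨h, h'⟩ | ⟨h, ⟨h', h''⟩ | ⟨h', h''⟩⟩
    · exact Or.inr (Or.inl ⟨h.symm, by dsimp only; rw [h']; ring⟩)
    · exact Or.inl (Or.inr ⟨h, Or.inr ⟨by dsimp only; omega, by dsimp only; rw [h'']; ring⟩⟩)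
    · exact Or.inl (Or.inr ⟨h, Or.inl ⟨by dsimp only; omega, by dsimp only; rw [h'']; ring⟩⟩)
  rw [aux_adj hn hne] at h ⊢
  exact h.elim (key _ _) (fun h => (key _ _ h).symm)

theorem adj_flip {n p : ℕ} (hn : 2 ≤ n) (hne : Even n)
    (u v : Fin (p + 1) × ZMod (2 * n)) (h : (AT n p).Adj u v) :
    (AT n p).Adj (u.1.rev, 3 - u.2) (v.1.rev, 3 - v.2) := by
  have key : ∀ u v : Fin (p + 1) × ZMod (2 * n), ATRel n p u v →
      ATRel n p (v.1.rev, 3 - v.2) (u.1.rev, 3 - u.2) := by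
    intro u v h
    have h1 := aux_val_sub hn hne 3 v.2
    rw [aux_val_three hn] at h1
    have h2 := aux_add_one hn hne u.2
    have h3 := aux_sub_one hn hne u.2
    have hu := u.1.2
    have hv := v.1.2
    rcases h with ⟨h, h'⟩ | ⟨h, ⟨h', h''⟩ | ⟨h', h''⟩⟩
    · exact Or.inl ⟨by dsimp only; rw [h], by dsimp only; rw [h']; ring⟩
    · rw [← h''] at h3
      exact Or.inr ⟨by simp only [Fin.val_rev]; omega,
        Or.inl ⟨by dsimp only; omega, by dsimp only; rw [h'']; ring⟩⟩
    · rw [← h''] at h2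
      exact Or.inr ⟨by simp only [Fin.val_rev]; omega,
        Or.inr ⟨by dsimp only; omega, by dsimp only; rw [h'']; ring⟩⟩
  rw [aux_adj hn hne] at h ⊢
  exact h.symm.imp (key _ _) (key _ _)

theorem mk_iso {V : Type*} (G : SimpleGraph V) (f g : V → V) (hfg : ∀ x, f (g x) = x)
    (hgf : ∀ x, g (f x) = x) (hf : ∀ u v, G.Adj u v → G.Adj (f u) (f v))
    (hg : ∀ u v, G.Adj u v → G.Adj (g u) (g v)) : ∃ α : G ≃g G, ∀ x, α x = f x := by
  refine ⟨⟨⟨f, g, hgf, hfg⟩, ?_⟩, fun x => rfl⟩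
  intro a b
  constructor
  · intro h
    have := hg _ _ h
    simpa [hgf] using this
  · exact hf a b

theorem same_lev {n p : ℕ} (hn : 2 ≤ n) (hne : Even n) (u v : Fin (p + 1) × ZMod (2 * n))
    (h : lev u = lev v) : ∃ α : (AT n p) ≃g (AT n p), α u = v := by
  obtain ⟨i, x⟩ := u
  obtain ⟨j, y⟩ := v
  unfold lev at h
  dsimp only at h
  obtain rfl : i = j := by apply Fin.ext; omega
  by_cases hxy : x.val % 4 = y.val % 4
  · have h1 := aux_val_sub hn hne y x
    have h2 := aux_val_sub hn hne x y
    obtain ⟨α, hα⟩ := mk_iso (AT n p) (fun u => (u.1, u.2 + (y - x))) (fun u => (u.1, u.2 + (x - y)))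
      (fun u => by ext <;> simp <;> ring) (fun u => by ext <;> simp <;> ring)
      (adj_shift hn hne _ (by omega)) (adj_shift hn hne _ (by omega))
    exact ⟨α, by rw [hα]; simp⟩
  · have h1 := aux_val_add hn hne x y
    obtain ⟨α, hα⟩ := mk_iso (AT n p) (fun u => (u.1, (x + y) - u.2)) (fun u => (u.1, (x + y) - u.2))
      (fun u => by ext <;> simp) (fun u => by ext <;> simp)
      (adj_refl hn hne _ (by omega)) (adj_refl hn hne _ (by omega))
    exact ⟨α, by rw [hα]; simp⟩

theorem same_mlev {n p : ℕ} (hn : 2 ≤ n) (hne : Even n) (u v : Fin (p + 1) × ZMod (2 * n))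
    (h : mlev u = mlev v) : ∃ α : (AT n p) ≃g (AT n p), α u = v := by
  have hu := lev_le u
  have hv := lev_le v
  by_cases h' : lev u = lev v
  · exact same_lev hn hne u v h'
  · obtain ⟨α, hα⟩ := mk_iso (AT n p) (fun u => (u.1.rev, 3 - u.2)) (fun u => (u.1.rev, 3 - u.2))
      (fun u => by ext <;> simp) (fun u => by ext <;> simp)
      (adj_flip hn hne) (adj_flip hn hne)
    have h1 := aux_val_sub hn hne 3 u.2
    rw [aux_val_three hn] at h1
    have hi := u.1.2
    have : lev (α u) = lev v := by
      have h2 : lev (α u) = 2 * p + 1 - lev u := by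
        rw [hα]; unfold lev; simp only [Fin.val_rev]; omega
      unfold mlev at h
      omega
    obtain ⟨β, hβ⟩ := same_lev hn hne _ _ this
    exact ⟨α.trans β, by simpa using hβ⟩

theorem orbit_eq {n p : ℕ} (hn : 2 ≤ n) (hne : Even n) (u : Fin (p + 1) × ZMod (2 * n)) :
    Set.range (fun α : (AT n p) ≃g (AT n p) => α u) = {v | mlev v = mlev u} := by
  ext v
  constructor
  · rintro ⟨α, rfl⟩
    exact mlev_aut hn hne α u
  · intro h
    exact same_mlev hn hne u v h.symm

theorem exists_mlev {n p : ℕ} (hn : 2 ≤ n) (k : ℕ) (hk : k ≤ p) :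
    ∃ u : Fin (p + 1) × ZMod (2 * n), mlev u = k := by
  rcases Nat.mod_two_eq_zero_or_one k with h | h
  · refine ⟨(⟨k / 2, by omega⟩, 0), ?_⟩
    unfold mlev lev
    simp only [ZMod.val_zero]
    omega
  · refine ⟨(⟨k / 2, by omega⟩, 2), ?_⟩
    unfold mlev lev
    simp only [aux_val_two hn]
    omega

theorem set0 {n p i : ℕ} (hi : 2 * i ≤ p) :
    Vset n p 0 i ∪ Vset n p 1 (p - i) = {v | mlev v = 2 * i} := by
  ext v
  have := v.1.2
  simp only [Vset, Set.mem_union, Set.mem_setOf_eq, mlev, lev]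
  omega

theorem set1 {n p i : ℕ} (hi : 2 * i + 1 ≤ p) :
    Vset n p 1 i ∪ Vset n p 0 (p - i) = {v | mlev v = 2 * i + 1} := by
  ext v
  have := v.1.2
  simp only [Vset, Set.mem_union, Set.mem_setOf_eq, mlev, lev]
  omega

theorem stmt2 (n p : ℕ) (hn : 2 ≤ n) (hne : Even n) (hp : 2 ≤ p) (hpe : Even p) :
    {S : Set (Fin (p + 1) × ZMod (2 * n)) |
        ∃ u, S = Set.range (fun α : (AT n p) ≃g (AT n p) => α u)} =
      {S | (∃ i ≤ (p - 2) / 2,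
          S = Vset n p 0 i ∪ Vset n p 1 (p - i) ∨ S = Vset n p 1 i ∪ Vset n p 0 (p - i)) ∨
        S = Vset n p 0 (p / 2) ∪ Vset n p 1 (p / 2)} := by
  obtain ⟨q, rfl⟩ := hpe
  have hmid : Vset n (q + q) 0 ((q + q) / 2) ∪ Vset n (q + q) 1 ((q + q) / 2)
      = {v | mlev v = 2 * q} := by
    rw [← set0 (by omega), show (q + q) / 2 = q by omega, show q + q - q = q by omega]
  ext S
  simp only [Set.mem_setOf_eq, orbit_eq hn hne, hmid]
  constructor
  · rintro ⟨u, rfl⟩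
    have hl := lev_le u
    have hm : mlev u ≤ 2 * q := by unfold mlev; omega
    generalize mlev u = k at hm
    by_cases hk : k = 2 * q
    · right; rw [hk]
    · left
      refine ⟨k / 2, by omega, ?_⟩
      rw [set0 (by omega), set1 (by omega)]
      rcases Nat.mod_two_eq_zero_or_one k with h | h
      · left; rw [show 2 * (k / 2) = k by omega]
      · right; rw [show 2 * (k / 2) + 1 = k by omega]
  · have fin : ∀ k ≤ q + q, ∃ u : Fin (q + q + 1) × ZMod (2 * n),
        {v : Fin (q + q + 1) × ZMod (2 * n) | mlev v = k} = {v | mlev v = mlev u} := by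
      intro k hk
      obtain ⟨u, hu⟩ := exists_mlev hn k hk
      exact ⟨u, by rw [hu]⟩
    rintro (⟨i, hi, rfl | rfl⟩ | rfl)
    · rw [set0 (by omega)]; exact fin _ (by omega)
    · rw [set1 (by omega)]; exact fin _ (by omega)
    · exact fin _ (by omega)
end

section
/- Let n ≥ 2 be an even integer and p ≥ 1 an integer. For every graph automorphism φ of AT(n,p), the image φ(V(C1)) of the vertex set of C1 equals either V(C1) or V(C2); consequently the restriction of φ to V(C1) is either an automorphism of C1 or an isomorphism from C1 onto C2. -/
open SimpleGraph

/-- Residue mod 4 of a position. -/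
def res4 {n : ℕ} (j : ZMod (2 * n)) : ℕ := j.val % 4

theorem res4_lt {n : ℕ} (j : ZMod (2 * n)) : res4 j < 4 := Nat.mod_lt _ (by norm_num)

theorem res4_succ {n : ℕ} (hn : 2 ≤ n) (hne : Even n) (j : ZMod (2 * n)) :
    res4 (j + 1) = (res4 j + 1) % 4 := by
  obtain ⟨m, rfl⟩ := hne
  have : NeZero (2 * (m + m)) := ⟨by omega⟩
  have : Fact (1 < 2 * (m + m)) := ⟨by omega⟩
  unfold res4
  rw [ZMod.val_add, ZMod.val_one, Nat.mod_mod_of_dvd _ ⟨m, by ring⟩]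
  omega

theorem res4_pred {n : ℕ} (hn : 2 ≤ n) (hne : Even n) (j : ZMod (2 * n)) :
    res4 (j - 1) = (res4 j + 3) % 4 := by
  have h := res4_succ hn hne (j - 1)
  rw [sub_add_cancel] at h
  have := res4_lt (j - 1)
  omega

theorem adj_iff {n p : ℕ} (hn : 2 ≤ n) (hne : Even n) (u v : Fin (p + 1) × ZMod (2 * n)) :
    (AT n p).Adj u v ↔
      ((u.1 : ℕ) = v.1 ∧ (v.2 = u.2 + 1 ∨ v.2 = u.2 - 1)) ∨
      ((u.1 : ℕ) + 1 = v.1 ∧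
        ((res4 u.2 = 2 ∧ v.2 = u.2 - 1) ∨ (res4 u.2 = 3 ∧ v.2 = u.2 + 1))) ∨
      ((v.1 : ℕ) + 1 = u.1 ∧
        ((res4 u.2 = 1 ∧ v.2 = u.2 + 1) ∨ (res4 u.2 = 0 ∧ v.2 = u.2 - 1))) := by
  obtain ⟨i, j⟩ := u
  obtain ⟨i', j'⟩ := v
  have e1 := res4_succ hn hne j
  have e2 := res4_pred hn hne j
  have e3 := res4_lt j
  have s1 : j = j' + 1 ↔ j' = j - 1 := ⟨fun h => by rw [h]; ring, fun h => by rw [h]; ring⟩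
  have s2 : j = j' - 1 ↔ j' = j + 1 := ⟨fun h => by rw [h]; ring, fun h => by rw [h]; ring⟩
  have e4 : j + 1 ≠ j := fun h => by rw [h] at e1; omega
  have e5 : j - 1 ≠ j := fun h => by rw [h] at e2; omega
  simp only [AT, SimpleGraph.fromRel_adj, ATRel, ← Fin.val_inj, ne_eq, Prod.mk.injEq, s1, s2]
  change (_ ∧ ((_ ∨ _ ∧ (res4 j = 2 ∧ _ ∨ res4 j = 3 ∧ _)) ∨ (_ ∨ _ ∧ (res4 j' = 2 ∧ _ ∨ res4 j' = 3 ∧ _)))) ↔ _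
  constructor
  · rintro ⟨h0, h⟩
    rcases h with (⟨h1, h2⟩ | ⟨h1, ⟨h2, h3⟩ | ⟨h2, h3⟩⟩) | (⟨h1, h2⟩ | ⟨h1, ⟨h2, h3⟩ | ⟨h2, h3⟩⟩)
    · exact Or.inl ⟨h1, Or.inl h2⟩
    · exact Or.inr (Or.inl ⟨h1, Or.inl ⟨h2, h3⟩⟩)
    · exact Or.inr (Or.inl ⟨h1, Or.inr ⟨h2, h3⟩⟩)
    · exact Or.inl ⟨h1.symm, Or.inr h2⟩
    · subst h3; exact Or.inr (Or.inr ⟨h1, Or.inl ⟨by omega, rfl⟩⟩)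
    · subst h3; exact Or.inr (Or.inr ⟨h1, Or.inr ⟨by omega, rfl⟩⟩)
  · rintro (⟨h1, h2 | h2⟩ | ⟨h1, ⟨h2, h3⟩ | ⟨h2, h3⟩⟩ | ⟨h1, ⟨h2, h3⟩ | ⟨h2, h3⟩⟩)
    · subst h2; exact ⟨fun h => e4 h.2.symm, Or.inl (Or.inl ⟨h1, rfl⟩)⟩
    · subst h2; exact ⟨fun h => e5 h.2.symm, Or.inr (Or.inl ⟨h1.symm, rfl⟩)⟩
    · exact ⟨fun h => by omega, Or.inl (Or.inr ⟨h1, Or.inl ⟨h2, h3⟩⟩)⟩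
    · exact ⟨fun h => by omega, Or.inl (Or.inr ⟨h1, Or.inr ⟨h2, h3⟩⟩)⟩
    · subst h3; exact ⟨fun h => by omega, Or.inr (Or.inr ⟨h1, Or.inl ⟨by omega, rfl⟩⟩)⟩
    · subst h3; exact ⟨fun h => by omega, Or.inr (Or.inr ⟨h1, Or.inr ⟨by omega, rfl⟩⟩)⟩

/-- `v` has at most two neighbours. -/
def LowDeg {V : Type*} (G : SimpleGraph V) (v : V) : Prop :=
  ∀ a b c, G.Adj v a → G.Adj v b → G.Adj v c → a = b ∨ b = c ∨ a = c

/-- `v` has low degree or is adjacent to a vertex of low degree. -/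
def NearLow {V : Type*} (G : SimpleGraph V) (v : V) : Prop :=
  LowDeg G v ∨ ∃ d, LowDeg G d ∧ G.Adj v d

/-- `u` and `v` are consecutive high degree vertices in a hexagon, followed by two low degree
vertices. -/
def Hex {V : Type*} (G : SimpleGraph V) (u v : V) : Prop :=
  ¬ LowDeg G u ∧ ¬ LowDeg G v ∧ ∃ a b c d, LowDeg G a ∧ LowDeg G b ∧ c ≠ u ∧ c ≠ a ∧
    G.Adj v a ∧ G.Adj a b ∧ G.Adj b c ∧ G.Adj c d ∧ G.Adj d u

/-- The automorphism invariant relation that turns out to describe the boundary cycles. -/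
def Bdry {V : Type*} (G : SimpleGraph V) (u v : V) : Prop :=
  G.Adj u v ∧ NearLow G u ∧ NearLow G v ∧ ¬ Hex G u v

theorem LowDeg.map {V : Type*} {G : SimpleGraph V} (f : G ≃g G) {v : V} (h : LowDeg G v) :
    LowDeg G (f v) := by
  intro a b c ha hb hc
  have key : ∀ x, G.Adj (f v) x → G.Adj v (f.symm x) := fun x hx => by
    rw [← f.map_adj_iff]; simpa using hx
  have := h _ _ _ (key a ha) (key b hb) (key c hc)
  simpa using this

theorem lowDeg_iff {V : Type*} {G : SimpleGraph V} (f : G ≃g G) (v : V) :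
    LowDeg G (f v) ↔ LowDeg G v :=
  ⟨fun h => by simpa using h.map f.symm, fun h => h.map f⟩

theorem NearLow.map {V : Type*} {G : SimpleGraph V} (f : G ≃g G) {v : V} (h : NearLow G v) :
    NearLow G (f v) := by
  rcases h with h | ⟨d, h, h'⟩
  · exact Or.inl (h.map f)
  · exact Or.inr ⟨f d, h.map f, f.map_adj_iff.2 h'⟩

theorem Hex.map {V : Type*} {G : SimpleGraph V} (f : G ≃g G) {u v : V} (h : Hex G u v) :
    Hex G (f u) (f v) := by
  obtain ⟨h1, h2, a, b, c, d, ha, hb, h3, h4, h5, h6, h7, h8, h9⟩ := h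
  refine ⟨by rwa [lowDeg_iff], by rwa [lowDeg_iff], f a, f b, f c, f d, ha.map f, hb.map f,
    by simpa using h3, by simpa using h4, ?_⟩
  simp only [f.map_adj_iff]
  exact ⟨h5, h6, h7, h8, h9⟩

theorem Bdry.map {V : Type*} {G : SimpleGraph V} (f : G ≃g G) {u v : V} (h : Bdry G u v) :
    Bdry G (f u) (f v) := by
  obtain ⟨h1, h2, h3, h4⟩ := h
  exact ⟨f.map_adj_iff.2 h1, h2.map f, h3.map f, fun h => h4 (by simpa using h.map f.symm)⟩

theorem lowDeg_AT {n p : ℕ} (hn : 2 ≤ n) (hne : Even n) (v : Fin (p + 1) × ZMod (2 * n)) :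
    LowDeg (AT n p) v ↔
      ((v.1 : ℕ) = 0 ∧ res4 v.2 < 2) ∨ ((v.1 : ℕ) = p ∧ 2 ≤ res4 v.2) := by
  obtain ⟨i, j⟩ := v
  have e1 := res4_succ hn hne j
  have e2 := res4_pred hn hne j
  have e3 := res4_lt j
  have e4 : j + 1 ≠ j - 1 := fun h => by rw [h] at e1; omega
  constructor
  · intro h
    by_contra hc
    have a1 : (AT n p).Adj (i, j) (i, j + 1) := by rw [adj_iff hn hne]; simp
    have a2 : (AT n p).Adj (i, j) (i, j - 1) := by rw [adj_iff hn hne]; simp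
    have hi := i.2
    have : ∃ k : Fin (p + 1), k ≠ i ∧ ∃ j', (AT n p).Adj (i, j) (k, j') := by
      simp only [adj_iff hn hne]
      dsimp only at hc
      by_cases hr : res4 j < 2
      · refine ⟨⟨i - 1, by omega⟩, fun h => ?_, ?_⟩
        · have := congrArg Fin.val h
          dsimp only at this; omega
        · rcases (by omega : res4 j = 0 ∨ res4 j = 1) with hj | hj
          · exact ⟨j - 1, Or.inr (Or.inr ⟨by dsimp only; omega, Or.inr ⟨hj, rfl⟩⟩)⟩
          · exact ⟨j + 1, Or.inr (Or.inr ⟨by dsimp only; omega, Or.inl ⟨hj, rfl⟩⟩)⟩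
      · refine ⟨⟨i + 1, by omega⟩, fun h => ?_, ?_⟩
        · have := congrArg Fin.val h
          dsimp only at this; omega
        · rcases (by omega : res4 j = 2 ∨ res4 j = 3) with hj | hj
          · exact ⟨j - 1, Or.inr (Or.inl ⟨by dsimp only, Or.inl ⟨hj, rfl⟩⟩)⟩
          · exact ⟨j + 1, Or.inr (Or.inl ⟨by dsimp only, Or.inr ⟨hj, rfl⟩⟩)⟩
    obtain ⟨k, hk, j', a3⟩ := this
    rcases h _ _ _ a1 a2 a3 with h | h | h
    · exact e4 (Prod.mk.inj h).2
    · exact hk (Prod.mk.inj h).1.symm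
    · exact hk (Prod.mk.inj h).1.symm
  · intro h a b c ha hb hc
    have key : ∀ w, (AT n p).Adj (i, j) w → w = (i, j + 1) ∨ w = (i, j - 1) := by
      rintro ⟨k, j'⟩ hw
      rw [adj_iff hn hne] at hw
      dsimp only at hw h
      have hk := k.2
      have hs : (i : ℕ) = k ∧ (j' = j + 1 ∨ j' = j - 1) := by
        rcases hw with hw | ⟨h1, ⟨h2, h3⟩ | ⟨h2, h3⟩⟩ | ⟨h1, ⟨h2, h3⟩ | ⟨h2, h3⟩⟩
        · exact hw
        all_goals omega
      obtain ⟨h1, h2⟩ := hs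
      have h1 : i = k := Fin.ext h1
      subst h1
      rcases h2 with rfl | rfl <;> simp
    rcases key a ha with rfl | rfl <;> rcases key b hb with rfl | rfl <;>
      rcases key c hc with rfl | rfl <;> simp

theorem nearLow_layer {n p : ℕ} (hn : 2 ≤ n) (hne : Even n) (v : Fin (p + 1) × ZMod (2 * n))
    (h : NearLow (AT n p) v) : (v.1 : ℕ) = 0 ∨ (v.1 : ℕ) = p := by
  rcases h with h | ⟨d, h, h'⟩
  · rw [lowDeg_AT hn hne] at h; omega
  · rw [lowDeg_AT hn hne] at h
    have h' := h'.symm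
    rw [adj_iff hn hne] at h'
    have := v.1.2
    omega

theorem layer_nearLow {n p : ℕ} (hn : 2 ≤ n) (hne : Even n)
    (v : Fin (p + 1) × ZMod (2 * n)) (h0 : (v.1 : ℕ) = 0) : NearLow (AT n p) v := by
  obtain ⟨i, j⟩ := v
  have e1 := res4_succ hn hne j
  have e2 := res4_pred hn hne j
  have e3 := res4_lt j
  by_cases hr : res4 j < 2
  · exact Or.inl ((lowDeg_AT hn hne _).2 (Or.inl ⟨h0, hr⟩))
  · right
    rcases (by omega : res4 j = 2 ∨ res4 j = 3) with hj | hj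
    · exact ⟨(i, j - 1), (lowDeg_AT hn hne _).2 (Or.inl ⟨h0, by dsimp only; omega⟩),
        (adj_iff hn hne _ _).2 (Or.inl ⟨rfl, Or.inr rfl⟩)⟩
    · exact ⟨(i, j + 1), (lowDeg_AT hn hne _).2 (Or.inl ⟨h0, by dsimp only; omega⟩),
        (adj_iff hn hne _ _).2 (Or.inl ⟨rfl, Or.inl rfl⟩)⟩

/-- Every inter-layer edge between boundary layers is a hexagon edge. -/
theorem hex_of_ne {n p : ℕ} (hn : 2 ≤ n) (hne : Even n) (hp : 1 ≤ p)
    (u v : Fin (p + 1) × ZMod (2 * n)) (h : (AT n p).Adj u v)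
    (hu : (u.1 : ℕ) = 0 ∨ (u.1 : ℕ) = p) (hv : (v.1 : ℕ) = 0 ∨ (v.1 : ℕ) = p)
    (huv : (u.1 : ℕ) ≠ v.1) : Hex (AT n p) u v := by
  obtain ⟨i, j⟩ := u
  obtain ⟨k, l⟩ := v
  have e0 := res4_lt j
  have e1 := res4_succ hn hne j
  have e2 := res4_pred hn hne j
  have e3 := res4_succ hn hne (j + 1)
  have e5 := res4_pred hn hne (j - 1)
  rw [adj_iff hn hne] at h
  dsimp only at h hu hv huv
  have c1 : j + 1 + 1 ≠ j := fun h => by rw [h] at e3; omega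
  have c2 : j - 1 - 1 ≠ j := fun h => by rw [h] at e5; omega
  have up : l = j - 1 → res4 j = 2 ∧ (i : ℕ) + 1 = k ∨ res4 j = 0 ∧ (k : ℕ) + 1 = i →
      Hex (AT n p) (i, j) (k, l) := by
    rintro rfl hh
    simp only [Hex, lowDeg_AT hn hne, adj_iff hn hne]
    refine ⟨by omega, by omega, (k, j), (k, j + 1), (k, j + 1 + 1), (i, j + 1),
      by dsimp only; omega, by dsimp only; omega, fun h => c1 (Prod.mk.inj h).2,
      fun h => c1 (Prod.mk.inj h).2, Or.inl ⟨rfl, Or.inl (by simp)⟩, Or.inl ⟨rfl, Or.inl rfl⟩,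
      Or.inl ⟨rfl, Or.inl rfl⟩, Or.inr ?_, Or.inl ⟨rfl, Or.inr (by simp)⟩⟩
    rcases hh with ⟨h1, h2⟩ | ⟨h1, h2⟩
    · exact Or.inr ⟨h2, Or.inr ⟨by dsimp only; omega, by simp⟩⟩
    · exact Or.inl ⟨h2, Or.inl ⟨by dsimp only; omega, by simp⟩⟩
  have down : l = j + 1 → res4 j = 3 ∧ (i : ℕ) + 1 = k ∨ res4 j = 1 ∧ (k : ℕ) + 1 = i →
      Hex (AT n p) (i, j) (k, l) := by
    rintro rfl hh
    simp only [Hex, lowDeg_AT hn hne, adj_iff hn hne]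
    refine ⟨by omega, by omega, (k, j), (k, j - 1), (k, j - 1 - 1), (i, j - 1),
      by dsimp only; omega, by dsimp only; omega, fun h => c2 (Prod.mk.inj h).2,
      fun h => c2 (Prod.mk.inj h).2, Or.inl ⟨rfl, Or.inr (by simp)⟩, Or.inl ⟨rfl, Or.inr rfl⟩,
      Or.inl ⟨rfl, Or.inr rfl⟩, Or.inr ?_, Or.inl ⟨rfl, Or.inl (by simp)⟩⟩
    rcases hh with ⟨h1, h2⟩ | ⟨h1, h2⟩
    · exact Or.inr ⟨h2, Or.inl ⟨by dsimp only; omega, by simp⟩⟩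
    · exact Or.inl ⟨h2, Or.inr ⟨by dsimp only; omega, by simp⟩⟩
  rcases h with ⟨h1, _⟩ | ⟨h1, ⟨h2, h3⟩ | ⟨h2, h3⟩⟩ | ⟨h1, ⟨h2, h3⟩ | ⟨h2, h3⟩⟩
  · exact absurd h1 huv
  · exact up h3 (Or.inl ⟨h2, h1⟩)
  · exact down h3 (Or.inl ⟨h2, h1⟩)
  · exact down h3 (Or.inr ⟨h2, h1⟩)
  · exact up h3 (Or.inr ⟨h2, h1⟩)

theorem not_hex {n p : ℕ} (hn : 2 ≤ n) (hne : Even n) (hp : 1 ≤ p)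
    (i : Fin (p + 1)) (hi : (i : ℕ) = 0) (j : ZMod (2 * n)) :
    ¬ Hex (AT n p) (i, j) (i, j + 1) := by
  have e0 := res4_lt j
  have e1 := res4_succ hn hne j
  have e2 := res4_pred hn hne j
  have e3 := res4_succ hn hne (j + 1)
  have e4 := res4_succ hn hne (j + 1 + 1)
  have e5 := res4_succ hn hne (j + 1 + 1 + 1)
  have e6 := res4_succ hn hne (j + 1 + 1 + 1 + 1)
  rintro ⟨h1, h2, ⟨a, a'⟩, ⟨b, b'⟩, ⟨c, c'⟩, ⟨d, d'⟩, ha, hb, h3, h4, h5, h6, h7, h8, h9⟩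
  rw [lowDeg_AT hn hne] at h1 h2 ha hb
  simp only [ne_eq, Prod.mk.injEq, ← Fin.val_inj] at h1 h2 ha hb h3 h4
  have hj : res4 j = 2 := by omega
  clear h1 h2
  rw [hj] at e1 e2
  norm_num at e1 e2
  rw [e1] at e3
  norm_num at e3
  rw [e3] at e4
  norm_num at e4
  rw [e4] at e5
  norm_num at e5
  rw [e5] at e6
  norm_num at e6
  have t1 : j + 1 - 1 = j := by ring
  have t2 : j + 1 + 1 - 1 = j + 1 := by ring
  have t3 : j + 1 + 1 + 1 - 1 = j + 1 + 1 := by ring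
  have t4 : j + 1 + 1 + 1 + 1 - 1 = j + 1 + 1 + 1:= by ring
  have A : (a : ℕ) = 0 ∧ a' = j + 1 + 1 := by
    clear hb h3 h4
    rw [adj_iff hn hne] at h5; dsimp only at h5; rw [t1] at h5
    rcases h5 with ⟨h, rfl | rfl⟩ | ⟨h, ⟨h', rfl⟩ | ⟨h', rfl⟩⟩ | ⟨h, ⟨h', rfl⟩ | ⟨h', rfl⟩⟩
    all_goals first | exact ⟨by omega, rfl⟩ | omega
  obtain ⟨A, rfl⟩ := A
  have B : (b : ℕ) = 0 ∧ b' = j + 1 + 1 + 1 := by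
    rw [adj_iff hn hne] at h6; dsimp only at h6; rw [t2] at h6
    rcases h6 with ⟨h, rfl | rfl⟩ | ⟨h, ⟨h', rfl⟩ | ⟨h', rfl⟩⟩ | ⟨h, ⟨h', rfl⟩ | ⟨h', rfl⟩⟩
    all_goals first | exact ⟨by omega, rfl⟩ | omega
  obtain ⟨B, rfl⟩ := B
  have C : (c : ℕ) = 0 ∧ c' = j + 1 + 1 + 1 + 1 := by
    rw [adj_iff hn hne] at h7; dsimp only at h7; rw [t3] at h7
    rcases h7 with ⟨h, rfl | rfl⟩ | ⟨h, ⟨h', rfl⟩ | ⟨h', rfl⟩⟩ | ⟨h, ⟨h', rfl⟩ | ⟨h', rfl⟩⟩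
    all_goals first | exact ⟨by omega, rfl⟩ | omega | exact absurd ⟨by omega, rfl⟩ h4
  obtain ⟨C, rfl⟩ := C
  have hne4 : ¬ (j + 1 + 1 + 1 + 1 = j) := fun h => h3 ⟨by omega, h⟩
  have u1 : ∀ x : ZMod (2 * n), j = x + 1 → x = j - 1 := fun x h => by rw [h]; ring
  have u2 : ∀ x : ZMod (2 * n), j = x - 1 → x = j + 1 := fun x h => by rw [h]; ring
  have h9' : (d' = j - 1 ∨ d' = j + 1) ∧ ((d : ℕ) = 0 ∨ d' = j - 1) := by
    rw [adj_iff hn hne] at h9; dsimp only at h9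
    rcases h9 with ⟨h, h' | h'⟩ | ⟨h, ⟨h', h''⟩ | ⟨h', h''⟩⟩ | ⟨h, ⟨h', h''⟩ | ⟨h', h''⟩⟩
    · exact ⟨Or.inl (u1 _ h'), Or.inl (by omega)⟩
    · exact ⟨Or.inr (u2 _ h'), Or.inl (by omega)⟩
    · omega
    · omega
    · exact ⟨Or.inl (u1 _ h''), Or.inr (u1 _ h'')⟩
    · exfalso
      rw [u2 _ h''] at h'
      omega
  have e9 : res4 d' % 2 = 1 := by
    rcases h9'.1 with h | h <;> rw [h] <;> omega
  rw [adj_iff hn hne] at h8; dsimp only at h8; rw [t4] at h8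
  have f1 : j + 1 + 1 + 1 + 1 + 1 = j - 1 → False := fun h => by
    rw [h] at e6; omega
  have f2 : j + 1 + 1 + 1 + 1 + 1 = j + 1 → False := fun h => hne4 (add_right_cancel h)
  have f3 : j + 1 + 1 + 1 = j - 1 → False := fun h => hne4 (by rw [h]; ring)
  have f4 : j + 1 + 1 + 1 = j + 1 → False := fun h => by rw [h] at e4; omega
  rcases h8 with ⟨h, rfl | rfl⟩ | ⟨h, ⟨h', rfl⟩ | ⟨h', rfl⟩⟩ | ⟨h, ⟨h', rfl⟩ | ⟨h', rfl⟩⟩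
  · exact h9'.1.elim f1 f2
  · exact h9'.1.elim f3 f4
  · exact h9'.1.elim f3 f4
  all_goals omega

theorem stmt3 (n p : ℕ) (hn : 2 ≤ n) (hne : Even n) (hp : 1 ≤ p)
    (φ : (AT n p) ≃g (AT n p)) :
    (fun v => φ v) '' layer n p 0 = layer n p 0 ∨
      (fun v => φ v) '' layer n p 0 = layer n p p := by
  have : NeZero (2 * n) := ⟨by omega⟩
  have step : ∀ j : ZMod (2 * n),
      ((φ (0, j)).1 : ℕ) = (φ (0, j + 1)).1 := by
    intro j
    have hb : Bdry (AT n p) (0, j) (0, j + 1) :=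
      ⟨(adj_iff hn hne _ _).2 (Or.inl ⟨rfl, Or.inl rfl⟩), layer_nearLow hn hne _ rfl,
        layer_nearLow hn hne _ rfl, not_hex hn hne hp 0 rfl j⟩
    obtain ⟨h1, h2, h3, h4⟩ := hb.map φ
    by_contra hc
    exact h4 (hex_of_ne hn hne hp _ _ h1 (nearLow_layer hn hne _ h2)
      (nearLow_layer hn hne _ h3) hc)
  have all : ∀ j : ZMod (2 * n), ((φ (0, j)).1 : ℕ) = (φ (0, 0)).1 := by
    have : ∀ m : ℕ, ((φ (0, (m : ZMod (2 * n)))).1 : ℕ) = (φ (0, 0)).1 := by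
      intro m
      induction m with
      | zero => simp
      | succ m ih => rw [← ih, step m]; push_cast; rfl
    intro j
    have := this j.val
    rwa [ZMod.natCast_zmod_val] at this
  have hl : ∀ i : Fin (p + 1), layer n p i = (fun j : ZMod (2 * n) => (i, j)) '' Set.univ := by
    intro i
    ext ⟨k, j⟩
    simp only [layer, Set.mem_ofPred_eq, Set.image_univ, Set.mem_range, Prod.mk.injEq,
      exists_eq_right, Fin.val_inj]
    exact eq_comm
  have hcard : ∀ i : Fin (p + 1), (layer n p i).ncard = 2 * n := by
    intro i
    rw [hl, Set.ncard_image_of_injective _ (fun a b h => (Prod.mk.inj h).2), Set.ncard_univ]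
    simp
  have main : (fun v => φ v) '' layer n p 0 = layer n p (φ (0, 0)).1 := by
    apply Set.eq_of_subset_of_ncard_le
    · rintro _ ⟨⟨i, j⟩, hi, rfl⟩
      have : i = 0 := Fin.ext hi
      subst this
      exact all j
    · rw [hcard, Set.ncard_image_of_injective _ φ.injective]
      exact (hcard 0).ge
    · exact Set.toFinite _
  rw [main]
  rcases nearLow_layer hn hne _ ((layer_nearLow hn hne (0, 0) rfl).map φ) with h | h
  · left; rw [h]
  · right; rw [h]
end

section
/- Let n ≥ 2 be an integer with n ≡ 2 (mod 4) and p ≥ 1 an integer. For every vertex u ∈ V^0_0 of AT(n,p), d(u, V^0_0) = (n² − 2)/2. -/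
open SimpleGraph

theorem AT_adj_step (n p : ℕ) (u v : Fin (p + 1) × ZMod (2 * n)) (h : (AT n p).Adj u v) :
    v.2 - u.2 = 1 ∨ v.2 - u.2 = -1 := by
  rw [AT, SimpleGraph.fromRel_adj] at h
  obtain ⟨-, (⟨-, h⟩ | ⟨-, ⟨-, h⟩ | ⟨-, h⟩⟩) | (⟨-, h⟩ | ⟨-, ⟨-, h⟩ | ⟨-, h⟩⟩)⟩ := h <;> rw [h] <;>
    simp

theorem AT_walk_lower (n p : ℕ) (hn : 2 ≤ n) (u v : Fin (p + 1) × ZMod (2 * n))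
    (w : (AT n p).Walk u v) : (v.2 - u.2).valMinAbs.natAbs ≤ w.length := by
  haveI : NeZero (2 * n) := ⟨by omega⟩
  haveI : Fact (1 < 2 * n) := ⟨by omega⟩
  induction w with
  | nil => simp
  | @cons a b c hab w ih =>
    rw [SimpleGraph.Walk.length_cons]
    have h1 : (b.2 - a.2).valMinAbs.natAbs ≤ 1 := by
      rcases AT_adj_step n p a b hab with h | h <;> rw [h]
      · rw [ZMod.valMinAbs_natAbs_eq_min, ZMod.val_one]; omega
      · rw [ZMod.natAbs_valMinAbs_neg, ZMod.valMinAbs_natAbs_eq_min, ZMod.val_one]; omega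
    have h2 := ZMod.natAbs_valMinAbs_add_le (c.2 - b.2) (b.2 - a.2)
    rw [sub_add_sub_cancel] at h2
    omega

theorem AT_walk_upper (n p : ℕ) (hn : 2 ≤ n) (i : Fin (p + 1)) (a : ZMod (2 * n)) (k : ℕ) :
    ∃ w : (AT n p).Walk (i, a) (i, a + k), w.length = k := by
  haveI : Fact (1 < 2 * n) := ⟨by omega⟩
  induction k with
  | zero => exact ⟨SimpleGraph.Walk.nil.copy rfl (by simp), by simp⟩
  | succ k ih =>
    obtain ⟨w, hw⟩ := ih
    have h : (AT n p).Adj (i, a + k) (i, a + (k + 1 : ℕ)) := by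
      rw [AT, SimpleGraph.fromRel_adj]
      refine ⟨?_, Or.inl (Or.inl ⟨rfl, by push_cast; ring⟩)⟩
      intro h
      simp at h
    exact ⟨w.concat h, by simp [hw]⟩

theorem AT_dist_layer (n p : ℕ) (hn : 2 ≤ n) (i : Fin (p + 1)) (a b : ZMod (2 * n)) :
    (AT n p).dist (i, a) (i, b) = min (b - a).val (2 * n - (b - a).val) := by
  haveI : NeZero (2 * n) := ⟨by omega⟩
  have key : ∀ a b : ZMod (2 * n), (∃ w : (AT n p).Walk (i, a) (i, b), w.length = (b - a).val) := by
    intro a b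
    obtain ⟨w, hw⟩ := AT_walk_upper n p hn i a (b - a).val
    exact ⟨w.copy rfl (by simp), by simpa using hw⟩
  apply le_antisymm
  · apply le_min
    · obtain ⟨w, hw⟩ := key a b
      exact hw ▸ SimpleGraph.dist_le w
    · obtain ⟨w, hw⟩ := key b a
      by_cases h0 : b - a = 0
      · have : b = a := sub_eq_zero.mp h0
        subst this
        simp
      · have h1 := SimpleGraph.dist_le w
        rw [SimpleGraph.dist_comm, hw, ← neg_sub, ZMod.neg_val, if_neg h0] at h1
        exact h1
  · obtain ⟨w, -⟩ := key a b
    obtain ⟨w', hw'⟩ := w.reachable.exists_walk_length_eq_dist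
    rw [← hw', ← ZMod.valMinAbs_natAbs_eq_min]
    exact AT_walk_lower n p hn _ _ w'

theorem sum_filter_mod (h : ℕ → ℚ) (k : ℕ) :
    ∑ d ∈ (Finset.range (4 * k)).filter (fun d => d % 4 / 2 = 0), h d
      = ∑ i ∈ Finset.range k, (h (4 * i) + h (4 * i + 1)) := by
  rw [Finset.sum_filter]
  induction k with
  | zero => simp
  | succ k ih =>
    rw [Finset.sum_range_succ _ k, ← ih, show 4 * (k + 1) = 4 * k + 1 + 1 + 1 + 1 by ring]
    simp only [Finset.sum_range_succ]
    rw [if_pos (by omega), if_pos (by omega), if_neg (by omega), if_neg (by omega)]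
    ring

theorem sum_cyc (m : ℕ) :
    ∑ d ∈ (Finset.range (4 * (2 * m + 1))).filter (fun d => d % 4 / 2 = 0),
      ((min d (4 * (2 * m + 1) - d) : ℕ) : ℚ) = 8 * (m : ℚ) ^ 2 + 8 * m + 1 := by
  rw [sum_filter_mod, show 2 * m + 1 = (m + 1) + m by ring, Finset.sum_range_add]
  have h1 : ∀ k : ℕ, ∑ i ∈ Finset.range k, (8 * (i : ℚ) + 1) = 4 * (k : ℚ) ^ 2 - 3 * k := by
    intro k
    induction k with
    | zero => simp
    | succ k ih => rw [Finset.sum_range_succ, ih]; push_cast; ring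
  have h2 : ∀ k : ℕ, ∑ i ∈ Finset.range k, (8 * (m : ℚ) - 8 * i - 1)
      = 8 * m * k - 4 * (k : ℚ) ^ 2 + 3 * k := by
    intro k
    induction k with
    | zero => simp
    | succ k ih => rw [Finset.sum_range_succ, ih]; push_cast; ring
  have e1 : ∀ i ∈ Finset.range (m + 1),
      ((min (4 * i) (4 * (m + 1 + m) - 4 * i) : ℕ) : ℚ)
        + ((min (4 * i + 1) (4 * (m + 1 + m) - (4 * i + 1)) : ℕ) : ℚ) = 8 * (i : ℚ) + 1 := by
    intro i hi
    rw [Finset.mem_range] at hi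
    rw [min_eq_left (by omega), min_eq_left (by omega)]
    push_cast; ring
  have e2 : ∀ i ∈ Finset.range m,
      ((min (4 * (m + 1 + i)) (4 * (m + 1 + m) - 4 * (m + 1 + i)) : ℕ) : ℚ)
        + ((min (4 * (m + 1 + i) + 1) (4 * (m + 1 + m) - (4 * (m + 1 + i) + 1)) : ℕ) : ℚ)
        = 8 * (m : ℚ) - 8 * i - 1 := by
    intro i hi
    rw [Finset.mem_range] at hi
    rw [min_eq_right (by omega), min_eq_right (by omega), Nat.cast_sub (by omega),
      Nat.cast_sub (by omega)]
    push_cast; ring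
  rw [Finset.sum_congr rfl e1, Finset.sum_congr rfl e2, h1, h2]
  push_cast; ring

theorem stmt6 (n p : ℕ) (hn : 2 ≤ n) (hn4 : n % 4 = 2) (hp : 1 ≤ p)
    (u : Fin (p + 1) × ZMod (2 * n)) (hu : u ∈ Vset n p 0 0) :
    ∑ᶠ y ∈ Vset n p 0 0, ((AT n p).dist u y : ℚ) = ((n : ℚ) ^ 2 - 2) / 2 := by
  haveI : NeZero (2 * n) := ⟨by omega⟩
  obtain ⟨m, rfl⟩ : ∃ m, n = 4 * m + 2 := ⟨n / 4, by omega⟩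
  obtain ⟨i, a⟩ := u
  obtain ⟨hi, ha⟩ := hu
  simp only at hi ha
  have hval : ∀ x y : ZMod (2 * (4 * m + 2)), (x + y).val % 4 = (x.val + y.val) % 4 := by
    intro x y
    rw [ZMod.val_add, Nat.mod_mod_of_dvd _ ⟨2 * m + 1, by ring⟩]
  have hN : 4 * (2 * m + 1) = 2 * (4 * m + 2) := by ring
  have hs := sum_cyc m
  rw [hN] at hs
  have hfin : (((4 * m + 2 : ℕ) : ℚ) ^ 2 - 2) / 2 = 8 * (m : ℚ) ^ 2 + 8 * m + 1 := by
    push_cast; ring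
  rw [hfin, ← hs, ← finsum_mem_coe_finset]
  by_cases h0 : a.val % 4 = 0
  · apply finsum_mem_eq_of_bijOn (fun y => (y.2 - a).val)
    · refine ⟨?_, ?_, ?_⟩
      · rintro ⟨j, y⟩ ⟨hj, hy⟩
        have h1 := hval (y - a) a
        rw [sub_add_cancel] at h1
        simp only at hj hy
        simp only [Finset.coe_filter, Finset.mem_range, Set.mem_setOf_eq]
        exact ⟨ZMod.val_lt _, by omega⟩
      · rintro ⟨j, y⟩ ⟨hj, hy⟩ ⟨j', y'⟩ ⟨hj', hy'⟩ h
        have h2 := ZMod.val_injective _ h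
        simp only [sub_left_inj] at h2 hj hj'
        exact Prod.ext (Fin.ext (hj.trans hj'.symm)) h2
      · intro d hd
        simp only [Finset.coe_filter, Finset.mem_range, Set.mem_setOf_eq] at hd
        have hv := ZMod.val_cast_of_lt hd.1
        refine ⟨(i, d + a), ⟨hi, ?_⟩, ?_⟩
        · have h1 := hval d a
          simp only
          omega
        · simp [hv]
    · rintro ⟨j, y⟩ ⟨hj, hy⟩
      obtain rfl : j = i := Fin.ext (hj.trans hi.symm)
      rw [AT_dist_layer _ _ hn]
  · apply finsum_mem_eq_of_bijOn (fun y => (a - y.2).val)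
    · refine ⟨?_, ?_, ?_⟩
      · rintro ⟨j, y⟩ ⟨hj, hy⟩
        have h1 := hval (a - y) y
        rw [sub_add_cancel] at h1
        simp only at hj hy
        simp only [Finset.coe_filter, Finset.mem_range, Set.mem_setOf_eq]
        exact ⟨ZMod.val_lt _, by omega⟩
      · rintro ⟨j, y⟩ ⟨hj, hy⟩ ⟨j', y'⟩ ⟨hj', hy'⟩ h
        have h2 := ZMod.val_injective _ h
        simp only [sub_right_inj] at h2 hj hj'
        exact Prod.ext (Fin.ext (hj.trans hj'.symm)) h2
      · intro d hd
        simp only [Finset.coe_filter, Finset.mem_range, Set.mem_setOf_eq] at hd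
        have hv := ZMod.val_cast_of_lt hd.1
        refine ⟨(i, a - d), ⟨hi, ?_⟩, ?_⟩
        · have h1 := hval (a - d) d
          rw [sub_add_cancel] at h1
          simp only
          omega
        · simp [hv]
    · rintro ⟨j, y⟩ ⟨hj, hy⟩
      obtain rfl : j = i := Fin.ext (hj.trans hi.symm)
      rw [SimpleGraph.dist_comm, AT_dist_layer _ _ hn]
end

section
/- Let n ≥ 2 be an even integer and p ≥ 1 an integer with n ≤ 4p + 4. For every vertex u ∈ V^0_0 of AT(n,p), d(u, V^1_p) = n²/4 + 2np + n. -/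
open SimpleGraph

/-- vertical part of the distance on the universal cover -/
def cc (k : ℤ) : ℤ := if 0 ≤ k then k - 2 * (k / 4) else -2 * (k / 4) - k % 2

/-- distance from `(0,0)` on the universal cover -/
def ff (i k : ℤ) : ℤ := max (max k (-k)) (2 * i + cc k)

/-- covering map of a layer -/
def phi (n : ℕ) (j0 : ZMod (2 * n)) (s k : ℤ) : ZMod (2 * n) := j0 + ((s * k : ℤ) : ZMod (2 * n))

theorem ff_side (i k k' : ℤ) (h : k' = k + 1 ∨ k' = k - 1) : ff i k' ≤ ff i k + 1 := by
  unfold ff cc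
  rcases h with rfl | rfl <;> split_ifs <;> omega

theorem ff_vert (i k k' : ℤ) (h : (k % 4 = 2 ∧ k' = k - 1) ∨ (k % 4 = 3 ∧ k' = k + 1)) :
    ff (i + 1) k' ≤ ff i k + 1 ∧ ff i k ≤ ff (i + 1) k' + 1 := by
  unfold ff cc
  rcases h with ⟨h, rfl⟩ | ⟨h, rfl⟩ <;> split_ifs <;> omega

theorem ff_desc (i k : ℤ) (hi : 0 ≤ i) (h : 0 < ff i k) :
    ff i (k + 1) + 1 = ff i k ∨ ff i (k - 1) + 1 = ff i k ∨
    (1 ≤ i ∧ k % 4 = 1 ∧ ff (i - 1) (k + 1) + 1 = ff i k) ∨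
    (1 ≤ i ∧ k % 4 = 0 ∧ ff (i - 1) (k - 1) + 1 = ff i k) := by
  have h4 : k % 4 = 0 ∨ k % 4 = 1 ∨ k % 4 = 2 ∨ k % 4 = 3 := by omega
  by_cases c1 : 0 < k ∧ 2 * i + cc k ≤ k ∧ ¬ (k % 4 = 0 ∧ 2 * i + cc k = k)
  · right; left
    unfold ff cc at *
    split_ifs at * <;> omega
  by_cases c2 : k < 0 ∧ 2 * i + cc k ≤ -k ∧ ¬ (k % 4 = 1 ∧ 2 * i + cc k = -k)
  · left
    unfold ff cc at *
    split_ifs at * <;> omega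
  have h5 : ff i k = 2 * i + cc k := by
    have : k = 0 → 0 ≤ cc k := by rintro rfl; simp [cc]
    unfold ff
    omega
  have h6 : (k < 2 * i + cc k ∨ (k % 4 = 0 ∧ 2 * i + cc k = k)) ∧
      (-k < 2 * i + cc k ∨ (k % 4 = 1 ∧ 2 * i + cc k = -k)) := by omega
  clear c1 c2
  rw [h5] at h ⊢
  rcases h4 with h4 | h4 | h4 | h4
  · right; right; right
    unfold ff cc at *
    split_ifs at * <;> omega
  · right; right; left
    unfold ff cc at *
    split_ifs at * <;> omega
  · right; left
    unfold ff cc at *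
    split_ifs at * <;> omega
  · rcases le_or_gt 0 k with hk | hk
    · right; left
      unfold ff cc at *
      split_ifs at * <;> omega
    · left
      unfold ff cc at *
      split_ifs at * <;> omega

theorem ff_zero (i k : ℤ) (hi : 0 ≤ i) (h : ff i k ≤ 0) : i = 0 ∧ k = 0 := by
  unfold ff cc at *
  split_ifs at * <;> omega

theorem phi_val (n : ℕ) (hn : 2 ≤ n) (hne : Even n) (j0 : ZMod (2 * n)) (s k : ℤ) :
    ((phi n j0 s k).val : ℤ) % 4 = ((j0.val : ℤ) + s * k) % 4 := by
  haveI : NeZero (2 * n) := ⟨by omega⟩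
  have h1 : phi n j0 s k = (((j0.val : ℤ) + s * k : ℤ) : ZMod (2 * n)) := by
    simp [phi]
  rw [h1, ZMod.val_intCast, Int.emod_emod_of_dvd]
  obtain ⟨a, rfl⟩ := hne
  exact ⟨a, by push_cast; ring⟩

theorem phi_add (n : ℕ) (j0 : ZMod (2 * n)) (s k t : ℤ) :
    phi n j0 s (k + t) = phi n j0 s k + ((s * t : ℤ) : ZMod (2 * n)) := by
  simp [phi]; ring

theorem step_lower (n p : ℕ) (hn : 2 ≤ n) (hne : Even n) (j0 : ZMod (2 * n)) (s : ℤ)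
    (H : (s = 1 ∧ j0.val % 4 = 0) ∨ (s = -1 ∧ j0.val % 4 = 1))
    (a b : Fin (p + 1) × ZMod (2 * n)) (hab : (AT n p).Adj a b) (k : ℤ)
    (hk : a.2 = phi n j0 s k) :
    ∃ k', b.2 = phi n j0 s k' ∧ ff (b.1 : ℕ) k' ≤ ff (a.1 : ℕ) k + 1 := by
  obtain ⟨i, x⟩ := a
  obtain ⟨i', x'⟩ := b
  simp only at *
  subst hk
  have hv := phi_val n hn hne j0 s k
  rw [AT, SimpleGraph.fromRel_adj] at hab
  obtain ⟨-, h | h⟩ := hab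
  · rcases h with ⟨h1, h2⟩ | ⟨h1, ⟨h2, h3⟩ | ⟨h2, h3⟩⟩ <;> simp only at *
    · subst h1
      refine ⟨k + s, ?_, ff_side _ _ _ ?_⟩
      · rw [h2, phi_add]; rcases H with ⟨rfl, _⟩ | ⟨rfl, _⟩ <;> simp
      · rcases H with ⟨rfl, _⟩ | ⟨rfl, _⟩ <;> omega
    · refine ⟨k + -s, ?_, ?_⟩
      · rw [h3, phi_add]; rcases H with ⟨rfl, _⟩ | ⟨rfl, _⟩ <;> simp [sub_eq_add_neg]
      · rw [← h1]; push_cast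
        refine (ff_vert _ _ _ ?_).1
        rcases H with ⟨rfl, _⟩ | ⟨rfl, _⟩ <;> omega
    · refine ⟨k + s, ?_, ?_⟩
      · rw [h3, phi_add]; rcases H with ⟨rfl, _⟩ | ⟨rfl, _⟩ <;> simp
      · rw [← h1]; push_cast
        refine (ff_vert _ _ _ ?_).1
        rcases H with ⟨rfl, _⟩ | ⟨rfl, _⟩ <;> omega
  · rcases h with ⟨h1, h2⟩ | ⟨h1, ⟨h2, h3⟩ | ⟨h2, h3⟩⟩ <;> simp only at *
    · subst h1
      refine ⟨k + -s, ?_, ff_side _ _ _ ?_⟩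
      · rw [phi_add, h2]; rcases H with ⟨rfl, _⟩ | ⟨rfl, _⟩ <;> simp
      · rcases H with ⟨rfl, _⟩ | ⟨rfl, _⟩ <;> omega
    · have e : x' = phi n j0 s (k + s) := by
        rw [phi_add, h3]; rcases H with ⟨rfl, _⟩ | ⟨rfl, _⟩ <;> simp
      refine ⟨k + s, e, ?_⟩
      have hv' := phi_val n hn hne j0 s (k + s)
      rw [← e] at hv'
      rw [← h1]; push_cast
      refine (ff_vert _ _ _ ?_).2
      rcases H with ⟨rfl, _⟩ | ⟨rfl, _⟩ <;> omega
    · have e : x' = phi n j0 s (k + -s) := by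
        rw [phi_add, h3]; rcases H with ⟨rfl, _⟩ | ⟨rfl, _⟩ <;> simp
      refine ⟨k + -s, e, ?_⟩
      have hv' := phi_val n hn hne j0 s (k + -s)
      rw [← e] at hv'
      rw [← h1]; push_cast
      refine (ff_vert _ _ _ ?_).2
      rcases H with ⟨rfl, _⟩ | ⟨rfl, _⟩ <;> omega

theorem walk_lower (n p : ℕ) (hn : 2 ≤ n) (hne : Even n) (j0 : ZMod (2 * n)) (s : ℤ)
    (H : (s = 1 ∧ j0.val % 4 = 0) ∨ (s = -1 ∧ j0.val % 4 = 1))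
    (a b : Fin (p + 1) × ZMod (2 * n)) (w : (AT n p).Walk a b) (k : ℤ)
    (hk : a.2 = phi n j0 s k) :
    ∃ k', b.2 = phi n j0 s k' ∧ ff (b.1 : ℕ) k' ≤ ff (a.1 : ℕ) k + w.length := by
  induction w generalizing k with
  | nil => exact ⟨k, hk, by simp⟩
  | cons h w ih =>
    obtain ⟨k1, e1, l1⟩ := step_lower n p hn hne j0 s H _ _ h k hk
    obtain ⟨k2, e2, l2⟩ := ih k1 e1
    refine ⟨k2, e2, ?_⟩
    rw [SimpleGraph.Walk.length_cons]
    push_cast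
    linarith

theorem adj_side (n p : ℕ) (hn : 2 ≤ n) (j0 : ZMod (2 * n)) (s : ℤ)
    (H : (s = 1 ∧ j0.val % 4 = 0) ∨ (s = -1 ∧ j0.val % 4 = 1)) (i : Fin (p + 1)) (k : ℤ) :
    (AT n p).Adj (i, phi n j0 s k) (i, phi n j0 s (k + 1)) := by
  haveI : Fact (1 < 2 * n) := ⟨by omega⟩
  rw [AT, SimpleGraph.fromRel_adj, phi_add]
  rcases H with ⟨rfl, _⟩ | ⟨rfl, _⟩
  · refine ⟨by simp, Or.inl (Or.inl ⟨rfl, by simp⟩)⟩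
  · refine ⟨by simp, Or.inr (Or.inl ⟨rfl, by simp⟩)⟩

theorem adj_vert (n p : ℕ) (hn : 2 ≤ n) (hne : Even n) (j0 : ZMod (2 * n)) (s : ℤ)
    (H : (s = 1 ∧ j0.val % 4 = 0) ∨ (s = -1 ∧ j0.val % 4 = 1)) (i i' : Fin (p + 1))
    (hi : (i : ℕ) + 1 = i') (k k' : ℤ)
    (h : (k % 4 = 2 ∧ k' = k - 1) ∨ (k % 4 = 3 ∧ k' = k + 1)) :
    (AT n p).Adj (i, phi n j0 s k) (i', phi n j0 s k') := by
  have hv := phi_val n hn hne j0 s k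
  rw [AT, SimpleGraph.fromRel_adj]
  refine ⟨fun e => ?_, Or.inl (Or.inr ⟨hi, ?_⟩)⟩
  · have := congrArg (fun t => (t.1 : ℕ)) e
    simp only at this
    omega
  · simp only
    rcases H with ⟨rfl, _⟩ | ⟨rfl, _⟩ <;> rcases h with ⟨h, rfl⟩ | ⟨h, rfl⟩
    · refine Or.inl ⟨by omega, ?_⟩
      rw [sub_eq_add_neg, phi_add]; simp [sub_eq_add_neg]
    · refine Or.inr ⟨by omega, ?_⟩
      rw [phi_add]; simp
    · refine Or.inr ⟨by omega, ?_⟩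
      rw [sub_eq_add_neg, phi_add]; simp
    · refine Or.inl ⟨by omega, ?_⟩
      rw [phi_add]; simp [sub_eq_add_neg]

theorem walk_upper (n p : ℕ) (hn : 2 ≤ n) (hne : Even n) (j0 : ZMod (2 * n)) (s : ℤ)
    (H : (s = 1 ∧ j0.val % 4 = 0) ∨ (s = -1 ∧ j0.val % 4 = 1)) (L : ℕ) :
    ∀ (i : Fin (p + 1)) (k : ℤ), ff (i : ℕ) k = L →
    ∃ w : (AT n p).Walk (i, phi n j0 s k) (0, phi n j0 s 0), w.length = L := by
  induction L with
  | zero =>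
    intro i k h
    obtain ⟨h1, rfl⟩ := ff_zero _ _ (by positivity) h.le
    have : i = 0 := by ext; simpa using h1
    subst this
    exact ⟨SimpleGraph.Walk.nil, rfl⟩
  | succ L ih =>
    intro i k h
    push_cast at h
    have key : ∃ (i' : Fin (p + 1)) (k' : ℤ), ff (i' : ℕ) k' = L ∧
        (AT n p).Adj (i, phi n j0 s k) (i', phi n j0 s k') := by
      rcases ff_desc (i : ℕ) k (by positivity) (by omega) with d | d | ⟨d1, d2, d3⟩ | ⟨d1, d2, d3⟩
      · exact ⟨i, k + 1, by omega, adj_side n p hn j0 s H i k⟩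
      · refine ⟨i, k - 1, by omega, ?_⟩
        have := adj_side n p hn j0 s H i (k - 1)
        rw [sub_add_cancel] at this
        exact this.symm
      · have hi := i.2
        refine ⟨⟨(i : ℕ) - 1, by omega⟩, k + 1, ?_, ?_⟩
        · have : (((i : ℕ) - 1 : ℕ) : ℤ) = (i : ℕ) - 1 := by omega
          simp only [this]; omega
        · exact (adj_vert n p hn hne j0 s H _ _ (by simp only; omega) _ _ (by omega)).symm
      · have hi := i.2
        refine ⟨⟨(i : ℕ) - 1, by omega⟩, k - 1, ?_, ?_⟩
        · have : (((i : ℕ) - 1 : ℕ) : ℤ) = (i : ℕ) - 1 := by omega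
          simp only [this]; omega
        · exact (adj_vert n p hn hne j0 s H _ _ (by simp only; omega) _ _ (by omega)).symm
    obtain ⟨i', k', e, ha⟩ := key
    obtain ⟨w, hw⟩ := ih i' k' e
    exact ⟨SimpleGraph.Walk.cons ha w, by simp [hw]⟩

theorem ff_nonneg (i k : ℤ) : 0 ≤ ff i k := by unfold ff; omega

theorem ff_shift (i k a : ℤ) (ha : 0 ≤ a) (hk : 0 ≤ k) : ff i k ≤ ff i (k + 4 * a) := by
  unfold ff cc
  split_ifs <;> omega

theorem ff_shift_neg (i k a : ℤ) (ha : 0 ≤ a) (hk : k < 0) : ff i k ≤ ff i (k - 4 * a) := by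
  unfold ff cc
  split_ifs <;> omega

theorem dist_eq (N p : ℕ) (hN : 1 ≤ N) (j0 : ZMod (2 * (2 * N))) (s : ℤ)
    (H : (s = 1 ∧ j0.val % 4 = 0) ∨ (s = -1 ∧ j0.val % 4 = 1)) (i : Fin (p + 1)) (k : ℤ)
    (hk0 : 0 ≤ k) (hk1 : k < 4 * N) :
    ((AT (2 * N) p).dist (0, j0) (i, phi (2 * N) j0 s k) : ℤ) =
      min (ff (i : ℕ) k) (ff (i : ℕ) (k - 4 * N)) := by
  have hn : 2 ≤ 2 * N := by omega
  have hne : Even (2 * N) := even_two_mul N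
  have h0 : phi (2 * N) j0 s 0 = j0 := by simp [phi]
  have up : ∀ k', phi (2 * N) j0 s k' = phi (2 * N) j0 s k →
      (AT (2 * N) p).Reachable (0, j0) (i, phi (2 * N) j0 s k) ∧
      ((AT (2 * N) p).dist (0, j0) (i, phi (2 * N) j0 s k) : ℤ) ≤ ff (i : ℕ) k' := by
    intro k' e
    obtain ⟨w, hw⟩ := walk_upper (2 * N) p hn hne j0 s H (ff (i : ℕ) k').toNat i k'
      (Int.toNat_of_nonneg (ff_nonneg _ _)).symm
    rw [e, h0] at w
    obtain ⟨w, hw⟩ : ∃ w : (AT (2 * N) p).Walk (i, phi (2 * N) j0 s k) (0, j0),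
      w.length = (ff (i : ℕ) k').toNat := by
      have := walk_upper (2 * N) p hn hne j0 s H (ff (i : ℕ) k').toNat i k'
        (Int.toNat_of_nonneg (ff_nonneg _ _)).symm
      rwa [e, h0] at this
    refine ⟨⟨w.reverse⟩, ?_⟩
    have := SimpleGraph.dist_le w.reverse
    rw [SimpleGraph.Walk.length_reverse, hw] at this
    have := ff_nonneg (i : ℕ) k'
    omega
  have hsh : phi (2 * N) j0 s (k - 4 * N) = phi (2 * N) j0 s k := by
    rw [sub_eq_add_neg, phi_add]
    have : (s * -(4 * (N : ℤ)) : ℤ) = ((2 * (2 * N) : ℕ) : ℤ) * (-s) := by push_cast; ring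
    rw [this]
    rw [Int.cast_mul, Int.cast_natCast, ZMod.natCast_self]
    simp
  apply le_antisymm
  · exact le_min (up k rfl).2 (up _ hsh).2
  · obtain ⟨w, hw⟩ := (up k rfl).1.exists_walk_length_eq_dist
    obtain ⟨k', e, l⟩ := walk_lower (2 * N) p hn hne j0 s H _ _ w 0 h0.symm
    rw [hw] at l
    have z : ff ((0 : Fin (p + 1)) : ℕ) 0 = 0 := by simp [ff, cc]
    simp only [z, zero_add] at l
    refine le_trans ?_ l
    simp only [phi, add_right_inj] at e
    rw [ZMod.intCast_eq_intCast_iff_dvd_sub] at e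
    obtain ⟨t, ht⟩ : ∃ t : ℤ, k' = k + 4 * (N * t) := by
      obtain ⟨t, ht⟩ := e
      push_cast at ht
      rcases H with ⟨rfl, _⟩ | ⟨rfl, _⟩
      · exact ⟨t, by linear_combination ht⟩
      · exact ⟨-t, by linear_combination -ht⟩
    rw [ht]
    rcases le_or_gt 0 t with h | h
    · exact min_le_of_left_le (ff_shift _ _ _ (by positivity) hk0)
    · apply min_le_of_right_le
      have e : k + 4 * (N * t) = (k - 4 * N) - 4 * (N * (-t - 1)) := by ring
      rw [e]
      exact ff_shift_neg _ _ _ (mul_nonneg (by positivity) (by omega)) (by omega)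

theorem val2 (N p m : ℤ) (h : N ≤ 2 * p + 2) (hm : 0 ≤ m) (hm' : m < N) (hp : 0 ≤ p) :
    min (ff p (4 * m + 2)) (ff p (4 * m + 2 - 4 * N)) = 2 * p + min (2 * m + 2) (2 * N - 2 * m) := by
  unfold ff cc
  split_ifs <;> omega

theorem val3 (N p m : ℤ) (h : N ≤ 2 * p + 2) (hm : 0 ≤ m) (hm' : m < N) (hp : 0 ≤ p) :
    min (ff p (4 * m + 3)) (ff p (4 * m + 3 - 4 * N)) =
      2 * p + min (2 * m + 3) (2 * N - 2 * m - 1) := by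
  unfold ff cc
  split_ifs <;> omega

/-- summand -/
def TT (N m : ℕ) : ℤ := min (2 * (m : ℤ) + 2) (2 * N - 2 * m) + min (2 * (m : ℤ) + 3) (2 * N - 2 * m - 1)

theorem sumTT (N : ℕ) : ∑ m ∈ Finset.range N, TT N m = (N : ℤ) ^ 2 + 2 * N := by
  induction N using Nat.twoStepInduction with
  | zero => simp
  | one => simp [TT]
  | more N ih _ =>
    rw [Finset.sum_range_succ, Finset.sum_range_succ']
    have h1 : ∀ m ∈ Finset.range N, TT (N + 2) (m + 1) = TT N m + 4 := by
      intro m _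
      unfold TT
      push_cast
      omega
    rw [Finset.sum_congr rfl h1, Finset.sum_add_distrib, ih]
    have h2 : TT (N + 2) 0 = 5 := by unfold TT; push_cast; omega
    have h3 : TT (N + 2) (N + 1) = 3 := by unfold TT; push_cast; omega
    rw [h2, h3]
    simp
    ring

theorem stmt7 (n p : ℕ) (hn : 2 ≤ n) (hne : Even n) (hp : 1 ≤ p) (hle : n ≤ 4 * p + 4)
    (u : Fin (p + 1) × ZMod (2 * n)) (hu : u ∈ Vset n p 0 0) :
    ∑ᶠ y ∈ Vset n p 1 p, ((AT n p).dist u y : ℚ) =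
      (n : ℚ) ^ 2 / 4 + 2 * (n : ℚ) * (p : ℚ) + (n : ℚ) := by
  obtain ⟨N, rfl⟩ := hne.two_dvd
  have hN : 1 ≤ N := by omega
  haveI : NeZero (2 * (2 * N)) := ⟨by omega⟩
  obtain ⟨i0, j0⟩ := u
  obtain ⟨hu1, hu2⟩ := hu
  simp only at hu1 hu2
  have hi0 : i0 = 0 := by ext; simpa using hu1
  subst hi0
  obtain ⟨s, H⟩ : ∃ s : ℤ, (s = 1 ∧ j0.val % 4 = 0) ∨ (s = -1 ∧ j0.val % 4 = 1) := by
    have : j0.val % 4 = 0 ∨ j0.val % 4 = 1 := by omega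
    rcases this with h | h
    · exact ⟨1, Or.inl ⟨rfl, h⟩⟩
    · exact ⟨-1, Or.inr ⟨rfl, h⟩⟩
  let g : ℕ × Bool → Fin (p + 1) × ZMod (2 * (2 * N)) := fun x =>
    (Fin.last p, phi (2 * N) j0 s (4 * x.1 + (if x.2 then 3 else 2)))
  let S : Finset (ℕ × Bool) := Finset.range N ×ˢ Finset.univ
  have hinj : Set.InjOn g S := by
    rintro ⟨m, b⟩ hm ⟨m', b'⟩ hm' e
    simp only [S, Finset.coe_product, Set.mem_prod, Finset.coe_range, Set.mem_Iio,
      Finset.coe_univ, Set.mem_univ, and_true] at hm hm'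
    simp only [g, Prod.mk.injEq, true_and, phi, add_right_inj] at e
    rw [ZMod.intCast_eq_intCast_iff_dvd_sub] at e
    have e2 : (4 * (N : ℤ)) ∣ (4 * m' + (if b' then 3 else 2)) - (4 * m + (if b then 3 else 2)) := by
      have : (((2 * (2 * N) : ℕ)) : ℤ) = 4 * N := by push_cast; ring
      rw [this] at e
      obtain ⟨t, ht⟩ := e
      rcases H with ⟨rfl, _⟩ | ⟨rfl, _⟩
      · exact ⟨t, by linear_combination ht⟩
      · exact ⟨-t, by linear_combination -ht⟩
    have e3 := Int.eq_zero_of_abs_lt_dvd e2 (by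
      rw [abs_lt]; cases b <;> cases b' <;> simp <;> omega)
    cases b <;> cases b' <;> simp at e3 ⊢ <;> omega
  have himg : Vset (2 * N) p 1 p = g '' S := by
    ext ⟨i, x⟩
    simp only [Vset, Set.mem_setOf_eq, Set.mem_image]
    constructor
    · rintro ⟨h1, h2⟩
      let r : ℤ := (s * ((x.val : ℤ) - j0.val)) % (4 * N)
      have hr0 : 0 ≤ r := Int.emod_nonneg _ (by omega)
      have hr1 : r < 4 * N := Int.emod_lt_of_pos _ (by omega)
      have hx : phi (2 * N) j0 s r = x := by
        have hd : r = s * ((x.val : ℤ) - j0.val) -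
            (4 * N) * ((s * ((x.val : ℤ) - j0.val)) / (4 * N)) := by
          have := Int.emod_add_mul_ediv (s * ((x.val : ℤ) - j0.val)) (4 * N)
          simp only [r]; linarith
        have hz : ((4 * (N : ℤ) : ℤ) : ZMod (2 * (2 * N))) = 0 := by
          have : (4 * (N : ℤ) : ℤ) = ((2 * (2 * N) : ℕ) : ℤ) := by push_cast; ring
          rw [this, Int.cast_natCast, ZMod.natCast_self]
        have hs : s * s = 1 := by rcases H with ⟨rfl, _⟩ | ⟨rfl, _⟩ <;> rfl
        generalize (s * ((x.val : ℤ) - j0.val)) / (4 * N) = q at hd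
        have hd2 : s * r = ((x.val : ℤ) - j0.val) - (4 * N) * (s * q) := by
          rw [hd]; linear_combination ((x.val : ℤ) - j0.val) * hs
        rw [phi, hd2, Int.cast_sub, Int.cast_mul (4 * (N : ℤ)), hz]
        simp
      have hv := phi_val (2 * N) hn hne j0 s r
      rw [hx] at hv
      have hr4 : r % 4 = 2 ∨ r % 4 = 3 := by
        rcases H with ⟨rfl, _⟩ | ⟨rfl, _⟩ <;> omega
      have hi : i = Fin.last p := by ext; simpa using h1
      clear_value r
      rcases hr4 with hr4 | hr4
      · refine ⟨((r / 4).toNat, false), ?_, ?_⟩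
        · simp [S]; omega
        · simp only [g, Prod.mk.injEq]
          refine ⟨hi.symm, ?_⟩
          rw [← hx]
          congr 1
          simp; omega
      · refine ⟨((r / 4).toNat, true), ?_, ?_⟩
        · simp [S]; omega
        · simp only [g, Prod.mk.injEq]
          refine ⟨hi.symm, ?_⟩
          rw [← hx]
          congr 1
          simp; omega
    · rintro ⟨⟨m, b⟩, hm, e⟩
      simp only [g, Prod.mk.injEq] at e
      obtain ⟨rfl, rfl⟩ := e
      refine ⟨by simp, ?_⟩
      have hv := phi_val (2 * N) hn hne j0 s (4 * m + (if b then 3 else 2))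
      change (phi (2 * N) j0 s (4 * m + (if b then 3 else 2))).val % 4 / 2 = 1
      generalize (phi (2 * N) j0 s (4 * m + (if b then 3 else 2))).val = z at hv ⊢
      rcases H with ⟨rfl, _⟩ | ⟨rfl, _⟩ <;> cases b <;>
        simp only [Bool.false_eq_true, if_false, if_true] at hv <;> omega
  rw [himg, finsum_mem_image hinj, finsum_mem_coe_finset, Finset.sum_product]
  have hterm : ∀ m ∈ Finset.range N,
      ∑ b : Bool, ((AT (2 * N) p).dist (0, j0) (g (m, b)) : ℚ) = ((4 * p + TT N m : ℤ) : ℚ) := by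
    intro m hm
    rw [Finset.mem_range] at hm
    have a2 := dist_eq N p hN j0 s H (Fin.last p) (4 * m + 2) (by omega) (by omega)
    have a3 := dist_eq N p hN j0 s H (Fin.last p) (4 * m + 3) (by omega) (by omega)
    rw [Fin.val_last, val2 _ _ _ (by omega) (by omega) (by omega) (by omega)] at a2
    rw [Fin.val_last, val3 _ _ _ (by omega) (by omega) (by omega) (by omega)] at a3
    have : (4 * p + TT N m : ℤ) =
      ((AT (2 * N) p).dist (0, j0) (g (m, true)) : ℤ) +
      ((AT (2 * N) p).dist (0, j0) (g (m, false)) : ℤ) := by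
      simp only [g, if_true, Bool.false_eq_true, if_false]
      rw [a2, a3]; unfold TT; ring
    rw [this, Fintype.sum_bool]
    push_cast
    rfl
  rw [Finset.sum_congr rfl hterm, ← Int.cast_sum, Finset.sum_add_distrib, sumTT]
  simp
  ring
end

section
/- Let n be an integer with n ≡ 2 (mod 4) and p ≥ 1 an integer with n > 4p + 4. For every vertex u ∈ V^0_0 of AT(n,p), d(u, V^1_p) = n²/2 + 4p² + 4p + 1. -/
open SimpleGraph

/-- Explicit distance function in the model coordinates. -/
def FF (m i t : ℕ) : ℕ :=
  min (max t (2 * i + (t / 4 * 2 + t % 4)))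
    (max (4 * m - t) (2 * i + (2 * (m - t / 4) - t % 2)))

/-- Cyclic successor on `{0, …, 4m-1}`. -/
def SS (m s t : ℕ) : Prop := t = s + 1 ∨ (s + 1 = 4 * m ∧ t = 0)

/-- Upward edges. -/
def UU (m s t : ℕ) : Prop := (s % 4 = 2 ∧ SS m t s) ∨ (s % 4 = 3 ∧ SS m s t)

/-- Adjacency in the model coordinates. -/
def MM (m i s k t : ℕ) : Prop :=
  (i = k ∧ (SS m s t ∨ SS m t s)) ∨ (i + 1 = k ∧ UU m s t) ∨ (k + 1 = i ∧ UU m t s)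

lemma FF_zero (m : ℕ) : FF m 0 0 = 0 := by simp [FF]

lemma FF_eq_zero (m i t : ℕ) (ht : t < 4 * m) (h : FF m i t = 0) : i = 0 ∧ t = 0 := by
  unfold FF at h; omega

lemma FF_0 (q e i : ℕ) : FF (q + 1 + e) i (4 * q) =
    min (max (4 * q) (2 * i + 2 * q)) (max (4 * e + 4) (2 * i + 2 * e + 2)) := by
  unfold FF
  rw [show 4 * q / 4 = q by omega, show 4 * q % 4 = 0 by omega, show 4 * q % 2 = 0 by omega]
  congr 2 <;> omega

lemma FF_1 (q e i : ℕ) : FF (q + 1 + e) i (4 * q + 1) =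
    min (max (4 * q + 1) (2 * i + 2 * q + 1)) (max (4 * e + 3) (2 * i + 2 * e + 1)) := by
  unfold FF
  rw [show (4 * q + 1) / 4 = q by omega, show (4 * q + 1) % 4 = 1 by omega,
    show (4 * q + 1) % 2 = 1 by omega]
  congr 2 <;> omega

lemma FF_2 (q e i : ℕ) : FF (q + 1 + e) i (4 * q + 2) =
    min (max (4 * q + 2) (2 * i + 2 * q + 2)) (max (4 * e + 2) (2 * i + 2 * e + 2)) := by
  unfold FF
  rw [show (4 * q + 2) / 4 = q by omega, show (4 * q + 2) % 4 = 2 by omega,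
    show (4 * q + 2) % 2 = 0 by omega]
  congr 2 <;> omega

lemma FF_3 (q e i : ℕ) : FF (q + 1 + e) i (4 * q + 3) =
    min (max (4 * q + 3) (2 * i + 2 * q + 3)) (max (4 * e + 1) (2 * i + 2 * e + 1)) := by
  unfold FF
  rw [show (4 * q + 3) / 4 = q by omega, show (4 * q + 3) % 4 = 3 by omega,
    show (4 * q + 3) % 2 = 1 by omega]
  congr 2 <;> omega

/-- Value at the first position of the next block. -/
lemma FF_4 (q e i : ℕ) : FF (q + 1 + (e + 1)) i (4 * q + 4) =
    min (max (4 * q + 4) (2 * i + 2 * q + 2)) (max (4 * e + 4) (2 * i + 2 * e + 2)) := by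
  have := FF_0 (q + 1) e i
  rw [show q + 1 + (e + 1) = q + 1 + 1 + e by ring, show 4 * q + 4 = 4 * (q + 1) by ring, this,
    show 2 * i + 2 * q + 2 = 2 * i + 2 * (q + 1) by ring]

lemma FF_00 (e i : ℕ) : FF (1 + e) i 0 = 2 * i := by
  have := FF_0 0 e i
  simp only [Nat.mul_zero, Nat.zero_add] at this
  rw [this]; rcases le_total i e with h | h <;> omega

lemma FF_last (e i : ℕ) : FF (1 + e) i (4 * e + 3) = 2 * i + 1 := by
  have := FF_3 e 0 i
  rw [show e + 1 + 0 = 1 + e by ring] at this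
  rw [this]; rcases le_total i e with h | h <;> omega

lemma FF_lipS (m i s t : ℕ) (hs : s < 4 * m) (ht : t < 4 * m) (h : SS m s t) :
    FF m i t ≤ FF m i s + 1 ∧ FF m i s ≤ FF m i t + 1 := by
  rcases h with h | ⟨h, rfl⟩
  · subst h
    obtain ⟨q, r, hr, rfl⟩ : ∃ q r, r < 4 ∧ s = 4 * q + r :=
      ⟨s / 4, s % 4, by omega, by omega⟩
    obtain ⟨e, rfl⟩ : ∃ e, m = q + 1 + e := ⟨m - q - 1, by omega⟩
    interval_cases r
    · rw [show 4 * q + 0 = 4 * q from rfl, FF_0, FF_1]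
      omega
    · rw [show 4 * q + 1 + 1 = 4 * q + 2 by ring, FF_1, FF_2]
      omega
    · rw [show 4 * q + 2 + 1 = 4 * q + 3 by ring, FF_2, FF_3]
      omega
    · obtain ⟨e, rfl⟩ : ∃ f, e = f + 1 := ⟨e - 1, by omega⟩
      rw [show 4 * q + 3 + 1 = 4 * q + 4 by ring, FF_3, FF_4]
      omega
  · obtain ⟨e, rfl⟩ : ∃ e, m = 1 + e := ⟨m - 1, by omega⟩
    obtain rfl : s = 4 * e + 3 := by omega
    rw [FF_last, FF_00]
    omega

lemma FF_lipU (m i s t : ℕ) (hs : s < 4 * m) (ht : t < 4 * m) (h : UU m s t) :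
    FF m (i + 1) t ≤ FF m i s + 1 ∧ FF m i s ≤ FF m (i + 1) t + 1 := by
  unfold UU SS at h
  rcases h with ⟨h1, h | h⟩ | ⟨h1, h | h⟩
  · obtain ⟨q, rfl⟩ : ∃ q, s = 4 * q + 2 := ⟨s / 4, by omega⟩
    obtain ⟨e, rfl⟩ : ∃ e, m = q + 1 + e := ⟨m - q - 1, by omega⟩
    obtain rfl : t = 4 * q + 1 := by omega
    rw [FF_1, FF_2]
    omega
  · omega
  · subst h
    obtain ⟨q, rfl⟩ : ∃ q, s = 4 * q + 3 := ⟨s / 4, by omega⟩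
    obtain ⟨e, rfl⟩ : ∃ e, m = q + 1 + (e + 1) := ⟨m - q - 2, by omega⟩
    rw [show 4 * q + 3 + 1 = 4 * q + 4 by ring, FF_3, FF_4]
    omega
  · obtain ⟨h, rfl⟩ := h
    obtain ⟨e, rfl⟩ : ∃ e, m = 1 + e := ⟨m - 1, by omega⟩
    obtain rfl : s = 4 * e + 3 := by omega
    rw [FF_last, FF_00]
    omega

lemma FF_lip (m i s k t : ℕ) (hs : s < 4 * m) (ht : t < 4 * m) (h : MM m i s k t) :
    FF m k t ≤ FF m i s + 1 := by
  rcases h with ⟨rfl, h | h⟩ | ⟨rfl, h⟩ | ⟨rfl, h⟩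
  · exact (FF_lipS m i s t hs ht h).1
  · exact (FF_lipS m i t s ht hs h).2
  · exact (FF_lipU m i s t hs ht h).1
  · exact (FF_lipU m k t s ht hs h).2

lemma FF_desc (m i t : ℕ) (ht : t < 4 * m) (h : FF m i t ≠ 0) :
    ∃ k s, k ≤ i ∧ s < 4 * m ∧ MM m k s i t ∧ FF m k s + 1 = FF m i t := by
  by_contra! hc
  have hR : t + 1 < 4 * m → FF m i (t + 1) + 1 ≠ FF m i t :=
    fun h => hc i _ le_rfl h (Or.inl ⟨rfl, Or.inr (Or.inl rfl)⟩)
  have hR' : t + 1 = 4 * m → FF m i 0 + 1 ≠ FF m i t :=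
    fun h => hc i _ le_rfl (by omega) (Or.inl ⟨rfl, Or.inr (Or.inr ⟨h, rfl⟩)⟩)
  have hL : ∀ s, s + 1 = t → FF m i s + 1 ≠ FF m i t :=
    fun s h => hc i _ le_rfl (by omega) (Or.inl ⟨rfl, Or.inl (Or.inl h.symm)⟩)
  have hD1 : ∀ k, k + 1 = i → t % 4 = 1 → FF m k (t + 1) + 1 ≠ FF m i t :=
    fun k h h1 => hc k _ (by omega) (by omega)
      (Or.inr (Or.inl ⟨h, Or.inl ⟨by omega, Or.inl (by omega)⟩⟩))
  have hD0 : ∀ k s, k + 1 = i → t % 4 = 0 → s + 1 = t → FF m k s + 1 ≠ FF m i t :=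
    fun k s h h1 h2 => hc k _ (by omega) (by omega)
      (Or.inr (Or.inl ⟨h, Or.inr ⟨by omega, Or.inl (by omega)⟩⟩))
  have hD0' : ∀ k s, k + 1 = i → t = 0 → s + 1 = 4 * m → FF m k s + 1 ≠ FF m i t :=
    fun k s h h1 h2 => hc k _ (by omega) (by omega)
      (Or.inr (Or.inl ⟨h, Or.inr ⟨by omega, Or.inr (by omega)⟩⟩))
  clear hc
  obtain ⟨q, r, hr, rfl⟩ : ∃ q r, r < 4 ∧ t = 4 * q + r := ⟨t / 4, t % 4, by omega, by omega⟩
  interval_cases r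
  · clear hR' hD1
    rcases Nat.eq_zero_or_pos q with hq | hq
    · subst hq
      obtain ⟨e, rfl⟩ : ∃ e, m = 1 + e := ⟨m - 1, by omega⟩
      rw [Nat.mul_zero, Nat.add_zero, FF_00] at h
      obtain ⟨k, rfl⟩ : ∃ k, i = k + 1 := ⟨i - 1, by omega⟩
      have := hD0' k (4 * e + 3) rfl rfl (by omega)
      rw [Nat.mul_zero, Nat.add_zero, FF_00, FF_last] at this
      omega
    · obtain ⟨q, rfl⟩ : ∃ c, q = c + 1 := ⟨q - 1, by omega⟩
      obtain ⟨e, rfl⟩ : ∃ e, m = q + 1 + (e + 1) := ⟨m - q - 2, by omega⟩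
      have h1 := hL (4 * q + 3) (by ring)
      have h3 := hR (by omega)
      rw [show 4 * (q + 1) + 0 + 1 = 4 * (q + 1) + 1 by ring,
        show q + 1 + (e + 1) = q + 1 + 1 + e by ring, FF_1] at h3
      rw [show 4 * (q + 1) + 0 = 4 * q + 4 by ring] at h1
      rw [show 4 * (q + 1) + 0 = 4 * (q + 1) from rfl, FF_0] at h3
      rw [FF_3, FF_4] at h1
      rcases Nat.eq_zero_or_pos i with hi | hi
      · subst hi
        clear hD0 hD0' hL hR h
        omega
      · obtain ⟨k, rfl⟩ : ∃ k, i = k + 1 := ⟨i - 1, by omega⟩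
        have h2 := hD0 k (4 * q + 3) rfl (by omega) (by ring)
        rw [show 4 * (q + 1) + 0 = 4 * q + 4 by ring, FF_3, FF_4] at h2
        clear hD0 hD0' hL hR h
        rcases le_total k q with a | a <;> rcases le_total k e with b | b <;> omega
  · obtain ⟨e, rfl⟩ : ∃ e, m = q + 1 + e := ⟨m - q - 1, by omega⟩
    have h1 := hL (4 * q) (by omega)
    have h3 := hR (by omega)
    rw [FF_0, FF_1] at h1
    rw [show 4 * q + 1 + 1 = 4 * q + 2 by ring, FF_1, FF_2] at h3
    rcases Nat.eq_zero_or_pos i with hi | hi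
    · subst hi
      clear hD0 hD0' hD1 hL hR hR' h
      omega
    · obtain ⟨k, rfl⟩ : ∃ k, i = k + 1 := ⟨i - 1, by omega⟩
      have h2 := hD1 k rfl (by omega)
      rw [show 4 * q + 1 + 1 = 4 * q + 2 by ring, FF_1, FF_2] at h2
      clear hD0 hD0' hD1 hL hR hR' h
      rcases le_total k q with a | a <;> rcases le_total k e with b | b <;> omega
  · obtain ⟨e, rfl⟩ : ∃ e, m = q + 1 + e := ⟨m - q - 1, by omega⟩
    have h1 := hL (4 * q + 1) (by omega)
    have h3 := hR (by omega)
    rw [FF_1, FF_2] at h1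
    rw [show 4 * q + 2 + 1 = 4 * q + 3 by ring, FF_2, FF_3] at h3
    clear hD0 hD0' hD1 hL hR hR' h
    omega
  · obtain ⟨e, rfl⟩ : ∃ e, m = q + 1 + e := ⟨m - q - 1, by omega⟩
    have h1 := hL (4 * q + 2) (by omega)
    rw [FF_2, FF_3] at h1
    rcases Nat.eq_zero_or_pos e with he | he
    · subst he
      have h3 := hR' (by omega)
      rw [FF_3, show q + 1 + 0 = 1 + q by ring, FF_00] at h3
      clear hD0 hD0' hD1 hL hR hR' h
      omega
    · obtain ⟨e, rfl⟩ : ∃ f, e = f + 1 := ⟨e - 1, by omega⟩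
      have h3 := hR (by omega)
      rw [show 4 * q + 3 + 1 = 4 * q + 4 by ring, FF_3, FF_4] at h3
      clear hD0 hD0' hD1 hL hR hR' h
      omega

lemma dist_eq_of_pot {V : Type*} (G : SimpleGraph V) (u : V) (F : V → ℕ) (h0 : F u = 0)
    (hz : ∀ x, F x = 0 → x = u) (hl : ∀ x y, G.Adj x y → F y ≤ F x + 1)
    (hd : ∀ x, F x ≠ 0 → ∃ y, G.Adj y x ∧ F y + 1 = F x) (x : V) : G.dist u x = F x := by
  have hub : ∀ k x, F x = k → ∃ w : G.Walk u x, w.length = k := by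
    intro k
    induction k with
    | zero =>
      intro x hx
      obtain rfl := hz x hx
      exact ⟨SimpleGraph.Walk.nil, rfl⟩
    | succ k ih =>
      intro x hx
      obtain ⟨y, hy, hF⟩ := hd x (by omega)
      obtain ⟨w, hw⟩ := ih y (by omega)
      exact ⟨w.concat hy, by simp [hw]⟩
  have hlb : ∀ (a b : V) (w : G.Walk a b), F b ≤ F a + w.length := by
    intro a b w
    induction w with
    | nil => simp
    | cons h w ih =>
      have := hl _ _ h
      simp only [SimpleGraph.Walk.length_cons]
      omega
  obtain ⟨w, hw⟩ := hub _ x rfl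
  apply le_antisymm
  · rw [← hw]; exact SimpleGraph.dist_le w
  · obtain ⟨w', hw'⟩ := (SimpleGraph.Walk.reachable w).exists_walk_length_eq_dist
    rw [← hw']
    have := hlb _ _ w'
    omega

lemma sum_g (p q : ℕ) (h : p ≤ q) :
    ∑ k ∈ Finset.range q, max (4 * k + 2) (2 * p + 2 * k + 2) = p ^ 2 + p + 2 * q ^ 2 := by
  induction q, h using Nat.le_induction with
  | base =>
    have : ∀ r, r ≤ p → ∑ k ∈ Finset.range r, max (4 * k + 2) (2 * p + 2 * k + 2)
        = 2 * p * r + r ^ 2 + r := by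
      intro r
      induction r with
      | zero => simp
      | succ r ih =>
        intro hr
        rw [Finset.sum_range_succ, ih (by omega), max_eq_right (by omega)]
        ring
    rw [this p le_rfl]; ring
  | succ q hq ih =>
    rw [Finset.sum_range_succ, ih, max_eq_left (by omega)]
    ring

lemma sum_range_four (m : ℕ) (f : ℕ → ℕ) :
    ∑ t ∈ (Finset.range (4 * m)).filter (fun t => t % 4 / 2 = 1), f t
      = ∑ k ∈ Finset.range m, (f (4 * k + 2) + f (4 * k + 3)) := by
  induction m with
  | zero => simp
  | succ m ih =>
    rw [Finset.sum_range_succ, ← ih, Finset.sum_filter, Finset.sum_filter,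
      show 4 * (m + 1) = 4 * m + 1 + 1 + 1 + 1 by ring]
    simp only [Finset.sum_range_succ]
    rw [if_neg (by omega), if_neg (by omega), if_pos (by omega), if_pos (by omega)]
    ring

lemma sum_FF (p q : ℕ) (h : p + 1 ≤ q) :
    ∑ k ∈ Finset.range (2 * q + 1),
      (FF (2 * q + 1) p (4 * k + 2) + FF (2 * q + 1) p (4 * k + 3))
      = 4 * p ^ 2 + 4 * p + 8 * q ^ 2 + 8 * q + 3 := by
  have e : 2 * q + 1 = q + (1 + q) := by ring
  rw [show Finset.range (2 * q + 1) = Finset.range (q + (1 + q)) by rw [e],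
    Finset.sum_range_add, Finset.sum_range_add]
  have h1 : ∑ k ∈ Finset.range q,
      (FF (2 * q + 1) p (4 * k + 2) + FF (2 * q + 1) p (4 * k + 3))
      = ∑ k ∈ Finset.range q, (2 * max (4 * k + 2) (2 * p + 2 * k + 2) + 1) := by
    apply Finset.sum_congr rfl
    intro k hk
    rw [Finset.mem_range] at hk
    unfold FF
    omega
  have h2 : ∑ k ∈ Finset.range q,
      (FF (2 * q + 1) p (4 * (q + (1 + k)) + 2) + FF (2 * q + 1) p (4 * (q + (1 + k)) + 3) + 1)
      = ∑ k ∈ Finset.range q, (2 * max (4 * k + 2) (2 * p + 2 * k + 2)) := by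
    rw [← Finset.sum_range_reflect (fun k => 2 * max (4 * k + 2) (2 * p + 2 * k + 2))]
    apply Finset.sum_congr rfl
    intro k hk
    rw [Finset.mem_range] at hk
    unfold FF
    omega
  have h3 : FF (2 * q + 1) p (4 * (q + 0) + 2) + FF (2 * q + 1) p (4 * (q + 0) + 3)
      = 8 * q + 3 := by
    unfold FF
    omega
  rw [Finset.sum_add_distrib (g := fun _ => 1), ← Finset.mul_sum, sum_g p q (by omega)] at h1
  rw [Finset.sum_add_distrib (g := fun _ => 1), ← Finset.mul_sum, sum_g p q (by omega)] at h2
  simp only [Finset.sum_const, Finset.card_range, smul_eq_mul, mul_one] at h1 h2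
  rw [h1, Finset.sum_range_one, h3]
  linarith

lemma main_sum (n p q : ℕ) (hn : n = 4 * q + 2) (hq : p + 1 ≤ q)
    (u : Fin (p + 1) × ZMod (2 * n)) (φ : ZMod (2 * n) → ℕ)
    (hinj : Function.Injective φ) (hlt : ∀ x, φ x < 4 * (2 * q + 1))
    (hu1 : (u.1 : ℕ) = 0) (hu2 : φ u.2 = 0)
    (hty : ∀ x : ZMod (2 * n), x.val % 4 / 2 = 1 ↔ φ x % 4 / 2 = 1)
    (hadj : ∀ x y, (AT n p).Adj x y ↔ MM (2 * q + 1) x.1 (φ x.2) y.1 (φ y.2)) :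
    ∑ᶠ y ∈ Vset n p 1 p, ((AT n p).dist u y : ℚ) =
      (n : ℚ) ^ 2 / 2 + 4 * (p : ℚ) ^ 2 + 4 * (p : ℚ) + 1 := by
  classical
  have : NeZero (2 * n) := ⟨by omega⟩
  have himg : Finset.univ.image φ = Finset.range (4 * (2 * q + 1)) := by
    apply Finset.eq_of_subset_of_card_le
    · intro t ht
      obtain ⟨x, -, rfl⟩ := Finset.mem_image.1 ht
      exact Finset.mem_range.2 (hlt x)
    · rw [Finset.card_image_of_injective _ hinj, Finset.card_range, Finset.card_univ, ZMod.card]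
      omega
  have hsurj : ∀ t, t < 4 * (2 * q + 1) → ∃ x, φ x = t := by
    intro t ht
    have : t ∈ Finset.univ.image φ := by rw [himg]; exact Finset.mem_range.2 ht
    obtain ⟨x, -, hx⟩ := Finset.mem_image.1 this
    exact ⟨x, hx⟩
  have hdist : ∀ y, (AT n p).dist u y = FF (2 * q + 1) y.1 (φ y.2) := by
    intro y
    apply dist_eq_of_pot (AT n p) u (fun y => FF (2 * q + 1) y.1 (φ y.2))
    · simp only [hu1, hu2]; exact FF_zero _
    · intro x hx
      obtain ⟨h1, h2⟩ := FF_eq_zero _ _ _ (hlt _) hx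
      exact Prod.ext (Fin.ext (by omega)) (hinj (by rw [h2, hu2]))
    · intro x z hxz
      exact FF_lip _ _ _ _ _ (hlt _) (hlt _) ((hadj x z).1 hxz)
    · intro x hx
      obtain ⟨k, s, hk, hs, hM, hF⟩ := FF_desc _ _ _ (hlt _) hx
      obtain ⟨z, rfl⟩ := hsurj s hs
      exact ⟨(⟨k, by omega⟩, z), (hadj _ _).2 hM, hF⟩
  have hV : Vset n p 1 p = ↑((Finset.univ.filter (fun x : ZMod (2 * n) => φ x % 4 / 2 = 1)).image
      (fun x => ((Fin.last p, x) : Fin (p + 1) × ZMod (2 * n)))) := by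
    ext ⟨i, x⟩
    simp only [Vset, Set.mem_ofPred_eq, Finset.coe_image, Finset.coe_filter, Finset.mem_univ,
      true_and, Set.mem_image, Prod.mk.injEq, hty]
    constructor
    · rintro ⟨h1, h2⟩
      exact ⟨x, h2, Fin.ext (by simp [h1]), rfl⟩
    · rintro ⟨x', h2, rfl, rfl⟩
      exact ⟨by simp, h2⟩
  rw [hV, finsum_mem_coe_finset, Finset.sum_image (by intro a _ b _ h; simpa using h)]
  simp only [hdist, Fin.val_last]
  have key : ∑ x ∈ Finset.univ.filter (fun x : ZMod (2 * n) => φ x % 4 / 2 = 1),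
      FF (2 * q + 1) p (φ x) = 4 * p ^ 2 + 4 * p + 8 * q ^ 2 + 8 * q + 3 := by
    rw [← sum_FF p q hq, ← sum_range_four (2 * q + 1) (fun t => FF (2 * q + 1) p t), ← himg,
      Finset.filter_image, Finset.sum_image (fun a _ b _ h => hinj h)]
  rw [← Nat.cast_sum, key, hn]
  push_cast
  ring

lemma adj_iff_s9 (n p q : ℕ) (hn : n = 4 * q + 2) (φ : ZMod (2 * n) → ℕ)
    (hS : (∀ x y, y = x + 1 ↔ SS (2 * q + 1) (φ x) (φ y)) ∧ (∀ x, x.val % 4 = φ x % 4) ∨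
      (∀ x y, y = x + 1 ↔ SS (2 * q + 1) (φ y) (φ x)) ∧ (∀ x, (x.val + φ x) % 4 = 1))
    (x y : Fin (p + 1) × ZMod (2 * n)) :
    (AT n p).Adj x y ↔ MM (2 * q + 1) x.1 (φ x.2) y.1 (φ y.2) := by
  have : Fact (1 < 2 * n) := ⟨by omega⟩
  have hrel : ∀ x y, ATRel n p x y → x ≠ y := by
    rintro ⟨i, x⟩ ⟨j, y⟩ h he
    simp only [Prod.mk.injEq] at he
    obtain ⟨rfl, rfl⟩ := he
    rcases h with ⟨_, h⟩ | ⟨h, _⟩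
    · simp at h
    · simp at h
  have h1 : (AT n p).Adj x y ↔ ATRel n p x y ∨ ATRel n p y x := by
    simp only [AT, SimpleGraph.fromRel_adj]
    constructor
    · exact fun h => h.2
    · intro h
      exact ⟨h.elim (hrel _ _) (fun h => (hrel _ _ h).symm), h⟩
  rw [h1]
  have hm : ∀ a b : ZMod (2 * n), b = a - 1 ↔ a = b + 1 := by
    intro a b
    rw [eq_sub_iff_add_eq, eq_comm]
  have c1 : ((x.1 : ℕ) = y.1) ↔ ((y.1 : ℕ) = x.1) := eq_comm
  unfold ATRel MM UU
  simp only [hm, Fin.ext_iff]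
  rw [← c1]
  clear h1 hm hrel c1
  rcases hS with ⟨h, h'⟩ | ⟨h, h'⟩
  · simp only [h, h']
    generalize SS (2 * q + 1) (φ x.2) (φ y.2) = A
    generalize SS (2 * q + 1) (φ y.2) (φ x.2) = B
    clear h h'
    grind
  · simp only [h]
    have e2 : ∀ x : ZMod (2 * n), x.val % 4 = 2 ↔ φ x % 4 = 3 := fun x => by
      have := h' x; omega
    have e3 : ∀ x : ZMod (2 * n), x.val % 4 = 3 ↔ φ x % 4 = 2 := fun x => by
      have := h' x; omega
    simp only [e2, e3]
    generalize SS (2 * q + 1) (φ x.2) (φ y.2) = A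
    generalize SS (2 * q + 1) (φ y.2) (φ x.2) = B
    clear h h' e2 e3
    grind

lemma succ_iff (n q : ℕ) (hn : n = 4 * q + 2) (a b : ZMod (2 * n)) :
    b = a + 1 ↔ SS (2 * q + 1) a.val b.val := by
  have : NeZero (2 * n) := ⟨by omega⟩
  have : Fact (1 < 2 * n) := ⟨by omega⟩
  have ha := ZMod.val_lt a
  have hb := ZMod.val_lt b
  rw [← (ZMod.val_injective (2 * n)).eq_iff, ZMod.val_add, ZMod.val_one]
  unfold SS
  rcases Nat.lt_or_ge (a.val + 1) (2 * n) with h | h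
  · rw [Nat.mod_eq_of_lt h]; omega
  · rw [show a.val + 1 = 2 * n by omega, Nat.mod_self]; omega

lemma val_add_mod (n q : ℕ) (hn : n = 4 * q + 2) (a b : ZMod (2 * n)) :
    (a + b).val % 4 = (a.val + b.val) % 4 := by
  have : NeZero (2 * n) := ⟨by omega⟩
  rw [ZMod.val_add, Nat.mod_mod_of_dvd]
  exact ⟨2 * q + 1, by omega⟩

theorem stmt9 (n p : ℕ) (hn4 : n % 4 = 2) (hp : 1 ≤ p) (hgt : 4 * p + 4 < n)
    (u : Fin (p + 1) × ZMod (2 * n)) (hu : u ∈ Vset n p 0 0) :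
    ∑ᶠ y ∈ Vset n p 1 p, ((AT n p).dist u y : ℚ) =
      (n : ℚ) ^ 2 / 2 + 4 * (p : ℚ) ^ 2 + 4 * (p : ℚ) + 1 := by
  obtain ⟨q, hn⟩ : ∃ q, n = 4 * q + 2 := ⟨n / 4, by omega⟩
  have : NeZero (2 * n) := ⟨by omega⟩
  obtain ⟨hu1, hu2⟩ := hu
  have hlt : ∀ x : ZMod (2 * n), x.val < 4 * (2 * q + 1) := by
    intro x
    have := ZMod.val_lt x
    omega
  have hc : u.2.val % 4 = 0 ∨ u.2.val % 4 = 1 := by omega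
  rcases hc with hc | hc
  · have ht : ∀ x : ZMod (2 * n), x.val % 4 = (x - u.2).val % 4 := by
      intro x
      have := val_add_mod n q hn (x - u.2) u.2
      rw [sub_add_cancel] at this
      omega
    refine main_sum n p q hn (by omega) u (fun x => (x - u.2).val) ?_ (fun x => hlt _) hu1
      (by simp) (fun x => by rw [ht x]) (adj_iff_s9 n p q hn _ (Or.inl ⟨?_, ht⟩))
    · intro x y h
      exact sub_left_injective (ZMod.val_injective _ h)
    · intro x y
      rw [← succ_iff n q hn, sub_add_eq_add_sub, sub_left_inj]
  · have ht : ∀ x : ZMod (2 * n), (x.val + (u.2 - x).val) % 4 = 1 := by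
      intro x
      have := val_add_mod n q hn x (u.2 - x)
      rw [add_sub_cancel] at this
      omega
    refine main_sum n p q hn (by omega) u (fun x => (u.2 - x).val) ?_ (fun x => hlt _) hu1
      (by simp) (fun x => by have := ht x; omega)
      (adj_iff_s9 n p q hn _ (Or.inr ⟨?_, ht⟩))
    · intro x y h
      exact sub_right_injective (ZMod.val_injective _ h)
    · intro x y
      rw [← succ_iff n q hn]
      constructor
      · rintro rfl; ring
      · intro h; linear_combination h
end
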